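/- arXiv:math/0408399 — 7 statements merged into one kernel-verified Lean document; each statement's English description precedes it below -/
import Mathlib

section
/- Let R be a commutative Noetherian ring and C a semidualizing R-module. The following conditions are equivalent: (ii) C has rank 1; (iii) C has rank; (iv) C is isomorphic to an ideal of R; (v) C is isomorphic to an ideal a of R such that every element of R/a is annihilated by a non-zerodivisor of R. -/
open CategoryTheory

/-- The `i`-th Ext module of two `R`-modules, over a commutative ring `R`. -/
noncomputable def ExtModule (R : Type) [CommRing R] (M N : ModuleCat.{0} R) (i : ℕ) :
    ModuleCat R :=
  ((Ext R (ModuleCat.{0} R) i).obj (Opposite.op M)).obj N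

/-- `C` is a semidualizing `R`-module: it is finitely generated, the homothety map
`R → Hom_R(C,C)` is bijective, and `Ext^i_R(C,C) = 0` for all `i > 0`. -/
def IsSemidualizing (R : Type) [CommRing R] (C : Type) [AddCommGroup C] [Module R C] : Prop :=
  Module.Finite R C ∧
  Function.Bijective (algebraMap R (Module.End R C)) ∧
  ∀ i : ℕ, 0 < i → Subsingleton (ExtModule R (ModuleCat.of R C) (ModuleCat.of R C) i)

/-- `M` has finite injective dimension over `R`: `Ext^i_R(-, M)` vanishes uniformly
for all large `i`. -/
def HasFiniteInjectiveDimension (R : Type) [CommRing R] (M : Type) [AddCommGroup M]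
    [Module R M] : Prop :=
  ∃ n : ℕ, ∀ (N : ModuleCat.{0} R) (i : ℕ), n < i →
    Subsingleton (ExtModule R N (ModuleCat.of R M) i)

/-- A Gorenstein local ring: a commutative Noetherian local ring having finite injective
dimension as a module over itself. -/
def IsGorensteinLocalRing (R : Type) [CommRing R] : Prop :=
  IsNoetherianRing R ∧ IsLocalRing R ∧ HasFiniteInjectiveDimension R R

/-- The length of an `R`-module, i.e. the Krull dimension of its lattice of submodules. -/
noncomputable def moduleLength (R M : Type) [CommRing R] [AddCommGroup M] [Module R M] :
    WithBot ℕ∞ :=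
  Order.krullDim (Submodule R M)

section Localization

variable {R M : Type*} [CommRing R] [AddCommGroup M] [Module R M]

/-- The localization at a prime `p` of a linear form on `M`. -/
noncomputable def localizedForm (p : Ideal R) [p.IsPrime] (f : M →ₗ[R] R) :
    LocalizedModule p.primeCompl M →ₗ[Localization.AtPrime p] Localization.AtPrime p :=
  IsLocalizedModule.mapExtendScalars p.primeCompl (LocalizedModule.mkLinearMap p.primeCompl M)
    (Algebra.linearMap R (Localization.AtPrime p)) (Localization.AtPrime p) f

lemma localizedForm_mkLinearMap (p : Ideal R) [p.IsPrime] (f : M →ₗ[R] R) (x : M) :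
    localizedForm p f (LocalizedModule.mkLinearMap p.primeCompl M x) =
      algebraMap R (Localization.AtPrime p) (f x) :=
  IsLocalizedModule.map_apply p.primeCompl (LocalizedModule.mkLinearMap p.primeCompl M)
    (Algebra.linearMap R (Localization.AtPrime p)) f x

lemma localizedForm_injective (p : Ideal R) [p.IsPrime] {f : M →ₗ[R] R}
    (hf : Function.Injective f) : Function.Injective (localizedForm p f) :=
  IsLocalizedModule.map_injective p.primeCompl (LocalizedModule.mkLinearMap p.primeCompl M)
    (Algebra.linearMap R (Localization.AtPrime p)) f hf

lemma localizedForm_surjective (p : Ideal R) [p.IsPrime] {f : M →ₗ[R] R} {x : M}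
    (hx : f x ∉ p) : Function.Surjective (localizedForm p f) := by
  rw [← LinearMap.range_eq_top]
  refine Ideal.eq_top_of_isUnit_mem _ ⟨_, localizedForm_mkLinearMap p f x⟩ ?_
  exact IsLocalization.map_units (M := p.primeCompl) _ ⟨f x, hx⟩

/-- A linear form on a module that is free of rank one at `p` is injective at `p` as soon as it
takes a value outside `p`. -/
lemma localizedForm_injective_of_notMem [Module.Finite R M] (p : Ideal R) [p.IsPrime]
    [Module.Free (Localization.AtPrime p) (LocalizedModule p.primeCompl M)]
    (h : Module.finrank (Localization.AtPrime p) (LocalizedModule p.primeCompl M) = 1)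
    {f : M →ₗ[R] R} {x : M} (hx : f x ∉ p) : Function.Injective (localizedForm p f) := by
  have e := LinearEquiv.ofFinrankEq (R := Localization.AtPrime p) (Localization.AtPrime p)
    (LocalizedModule p.primeCompl M) (by rw [h, Module.finrank_self])
  have hs : Function.Surjective (localizedForm p f ∘ₗ e.toLinearMap) :=
    (localizedForm_surjective p hx).comp e.surjective
  have hi := OrzechProperty.injective_of_surjective_endomorphism _ hs
  exact Function.Injective.of_comp_right (f := localizedForm p f) (g := e) hi e.surjective

/-- A finitely presented module that is free of rank one at a prime `p` carries a linear form
taking a value outside `p`. -/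
lemma exists_linearForm_notMem [Module.FinitePresentation R M] (p : Ideal R) [p.IsPrime]
    [Module.Free (Localization.AtPrime p) (LocalizedModule p.primeCompl M)]
    (h : Module.finrank (Localization.AtPrime p) (LocalizedModule p.primeCompl M) = 1) :
    ∃ (f : M →ₗ[R] R) (x : M), f x ∉ p := by
  have e := LinearEquiv.ofFinrankEq (R := Localization.AtPrime p)
    (LocalizedModule p.primeCompl M) (Localization.AtPrime p) (by rw [h, Module.finrank_self])
  obtain ⟨f, s, hf⟩ := Module.FinitePresentation.exists_lift_of_isLocalizedModule p.primeCompl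
    (Algebra.linearMap R (Localization.AtPrime p))
    (e.toLinearMap.restrictScalars R ∘ₗ LocalizedModule.mkLinearMap p.primeCompl M)
  obtain ⟨⟨x, t⟩, hx⟩ := IsLocalizedModule.surj p.primeCompl
    (LocalizedModule.mkLinearMap p.primeCompl M) (e.symm 1)
  refine ⟨f, x, fun hmem ↦ ?_⟩
  have hfx : algebraMap R (Localization.AtPrime p) (f x) =
      algebraMap R (Localization.AtPrime p) (s * t) := by
    have := LinearMap.congr_fun hf x
    simp only [LinearMap.coe_comp, Function.comp_apply, Algebra.linearMap_apply,
      LinearMap.smul_apply, LinearMap.restrictScalars_apply, LinearEquiv.coe_coe] at this hx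
    rw [this, ← hx, Submonoid.smul_def, Submonoid.smul_def, ← LinearEquiv.coe_coe,
      LinearMap.map_smul_of_tower, LinearEquiv.coe_coe, LinearEquiv.apply_symm_apply,
      smul_smul, Algebra.smul_def, mul_one]
  have hu := IsLocalization.map_units (Localization.AtPrime p) (s * t)
  rw [Submonoid.coe_mul, ← hfx, IsLocalization.AtPrime.isUnit_to_map_iff _ p] at hu
  exact hu hmem

/-- If every endomorphism of a finitely presented module `M` is a unique homothety, then `M` can
only be free of rank one at a prime. -/
lemma finrank_localizedModule_eq_one [Module.FinitePresentation R M]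
    (h : Function.Bijective (algebraMap R (Module.End R M))) (p : Ideal R) [p.IsPrime]
    [Module.Free (Localization.AtPrime p) (LocalizedModule p.primeCompl M)] :
    Module.finrank (Localization.AtPrime p) (LocalizedModule p.primeCompl M) = 1 := by
  let A := Localization.AtPrime p
  let N := LocalizedModule p.primeCompl M
  let e : R ≃ₗ[R] (M →ₗ[R] M) := LinearEquiv.ofBijective (Algebra.linearMap R (Module.End R M)) h
  let g : (M →ₗ[R] M) →ₗ[R] (N →ₗ[A] N) := IsLocalizedModule.mapExtendScalars p.primeCompl
    (LocalizedModule.mkLinearMap p.primeCompl M) (LocalizedModule.mkLinearMap p.primeCompl M) A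
  have : IsLocalizedModule p.primeCompl (g ∘ₗ e.toLinearMap) :=
    IsLocalizedModule.of_linearEquiv_right _ _ _
  let E : A ≃ₗ[A] (N →ₗ[A] N) := (IsLocalizedModule.linearEquiv p.primeCompl
    (Algebra.linearMap R A) (g ∘ₗ e.toLinearMap)).extendScalarsOfIsLocalization p.primeCompl A
  have hE := E.finrank_eq
  rw [Module.finrank_self, Module.finrank_linearMap] at hE
  exact Nat.eq_one_of_mul_eq_one_right hE.symm

/-- If, for each prime `p` of a finite set, some linear form on `M` takes a value outside `p`,
and the primes are pairwise incomparable, then a single linear form does so for all of them. -/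
lemma exists_linearForm_forall_notMem (s : Finset (Ideal R)) (hp : ∀ p ∈ s, p.IsPrime)
    (hs : IsAntichain (· ≤ ·) (s : Set (Ideal R)))
    (h : ∀ p ∈ s, ∃ (f : M →ₗ[R] R) (x : M), f x ∉ p) :
    ∃ f : M →ₗ[R] R, ∀ p ∈ s, ∃ x, f x ∉ p := by
  classical
  have ht : ∀ p ∈ s, ∃ t ∉ p, ∀ q ∈ s, q ≠ p → t ∈ q := by
    intro p hps
    have hle : ¬ (s.erase p).inf id ≤ p := by
      rw [(hp p hps).inf_le']
      rintro ⟨q, hq, hqp⟩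
      obtain ⟨hne, hqs⟩ := Finset.mem_erase.mp hq
      exact hs hqs hps hne hqp
    obtain ⟨t, ht, htp⟩ := SetLike.not_le_iff_exists.mp hle
    refine ⟨t, htp, fun q hq hne ↦ ?_⟩
    exact (Finset.inf_le (f := id) (Finset.mem_erase.mpr ⟨hne, hq⟩)) ht
  choose! t htp htq using ht
  choose! f x hfx using h
  refine ⟨∑ q ∈ s, t q • f q, fun p hps ↦ ⟨x p, fun hmem ↦ ?_⟩⟩
  rw [LinearMap.sum_apply, ← Finset.add_sum_erase _ _ hps,
    Ideal.add_mem_iff_left _ (Ideal.sum_mem _ fun q hq ↦ ?_)] at hmem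
  · exact ((hp p hps).mem_or_mem hmem).elim (htp p hps) (hfx p hps)
  · obtain ⟨hne, hqs⟩ := Finset.mem_erase.mp hq
    exact p.mul_mem_right _ (htq q hqs p hps hne.symm)

end Localization

section Noetherian

variable {R M : Type*} [CommRing R] [IsNoetherianRing R] [AddCommGroup M] [Module R M]

lemma Ideal.exists_mem_nonZeroDivisors {I : Ideal R}
    (h : ∀ p ∈ associatedPrimes R R, ¬ I ≤ p) : ∃ r ∈ I, r ∈ nonZeroDivisors R := by
  by_contra! hI
  have hsub : (I : Set R) ⊆ ⋃ p ∈ associatedPrimes R R, p := by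
    rw [biUnion_associatedPrimes_eq_compl_nonZeroDivisors]
    exact hI
  obtain ⟨p, hp, hle⟩ := (I.subset_union_prime_finite (associatedPrimes.finite R R) (f := id)
    0 0 fun _ hp _ _ ↦ hp.1).1 hsub
  exact h p hp hle

/-- An ideal isomorphic to a faithful module contains a non-zerodivisor. -/
lemma exists_mem_nonZeroDivisors_of_linearEquiv [FaithfulSMul R M] {a : Ideal R} (e : M ≃ₗ[R] a) :
    ∃ r ∈ a, r ∈ nonZeroDivisors R := by
  by_contra! h
  have hlt := Ideal.bot_lt_annihilator_of_disjoint_nonZeroDivisors (Set.disjoint_left.mpr h)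
  rw [← e.annihilator_eq, Module.annihilator_eq_bot.mpr inferInstance] at hlt
  exact hlt.false

/-- If every endomorphism of a finite module `M` is a unique homothety, then every non-zerodivisor
of the ring is `M`-regular. -/
lemma torsion_eq_bot_of_bijective_algebraMap [Module.Finite R M]
    (h : Function.Bijective (algebraMap R (Module.End R M))) : Submodule.torsion R M = ⊥ := by
  have hom_zero : Subsingleton (M →ₗ[R] Submodule.torsion R M) := by
    refine subsingleton_of_forall_eq 0 fun g ↦ ?_
    obtain ⟨u, hu⟩ := h.2 ((Submodule.torsion R M).subtype ∘ₗ g)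
    have hgu : ∀ x, (g x : M) = u • x := fun x ↦ (LinearMap.congr_fun hu x).symm
    have hr : ∃ r : nonZeroDivisors R, ∀ x, r • (g x : M) = 0 := by
      obtain ⟨s, hs⟩ := Module.Finite.fg_top (R := R) (M := M)
      choose r hr using fun x ↦ (Submodule.mem_torsion_iff (R := R) (g x : M)).mp (g x).2
      refine ⟨∏ x ∈ s, r x, fun x ↦ ?_⟩
      have hle : (⊤ : Submodule R M) ≤ LinearMap.ker
          ((∏ x ∈ s, r x) • ((Submodule.torsion R M).subtype ∘ₗ g)) := by
        classical
        rw [← hs, Submodule.span_le]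
        intro y hy
        change (∏ x ∈ s, r x) • (g y : M) = 0
        rw [← Finset.prod_erase_mul _ _ hy, mul_smul, hr, smul_zero]
      exact hle (Submodule.mem_top (x := x))
    obtain ⟨r, hr⟩ := hr
    have hru : (r : R) * u = 0 := by
      refine h.1 (LinearMap.ext fun x ↦ ?_)
      have := hr x
      rw [hgu, Submonoid.smul_def, smul_smul] at this
      simpa only [map_zero, Module.algebraMap_end_apply, LinearMap.zero_apply] using this
    have hu0 : u = 0 := by
      rwa [mul_comm, mul_right_mem_nonZeroDivisors_eq_zero_iff r.2] at hru
    ext x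
    simp [hgu, hu0]
  obtain ⟨r, hr, hreg⟩ := IsSMulRegular.subsingleton_linearMap_iff.mp hom_zero
  have hr0 : r = 0 := h.1 (LinearMap.ext fun x ↦ by
    simpa using Module.mem_annihilator.mp hr x)
  rw [hr0, IsSMulRegular.zero_iff_subsingleton] at hreg
  exact Submodule.subsingleton_iff_eq_bot.mp hreg

/-- A finite torsion-free module that is free of rank one at every associated prime of the ring is
isomorphic to an ideal. -/
lemma exists_injective_linearForm [Module.Finite R M] (htors : Submodule.torsion R M = ⊥)
    (h : ∀ (p : Ideal R) [p.IsPrime], p ∈ associatedPrimes R R →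
      Module.Free (Localization.AtPrime p) (LocalizedModule p.primeCompl M) ∧
      Module.finrank (Localization.AtPrime p) (LocalizedModule p.primeCompl M) = 1) :
    ∃ f : M →ₗ[R] R, Function.Injective f := by
  have := Module.finitePresentation_of_finite R M
  have hfin := associatedPrimes.finite R R
  have hmax : {p | Maximal (· ∈ associatedPrimes R R) p}.Finite :=
    hfin.subset fun p hp ↦ hp.prop
  obtain ⟨f, hf⟩ := exists_linearForm_forall_notMem (M := M) hmax.toFinset
    (fun p hp ↦ (hmax.mem_toFinset.mp hp).prop.isPrime)
    (by simpa using setOfPred_maximal_antichain _)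
    (fun p hp ↦ by
      have hp' := (hmax.mem_toFinset.mp hp).prop
      have := hp'.isPrime
      have := (h p hp').1
      exact exists_linearForm_notMem p (h p hp').2)
  refine ⟨f, (injective_iff_map_eq_zero f).mpr fun y hy ↦ ?_⟩
  suffices y ∈ Submodule.torsion R M by simpa [htors] using this
  obtain ⟨r, hr, hreg⟩ := Ideal.exists_mem_nonZeroDivisors (R := R)
    (I := LinearMap.ker (LinearMap.toSpanSingleton R M y)) fun p hp hle ↦ by
      have := hp.isPrime
      have := (h p hp).1
      obtain ⟨q, hpq, hq⟩ := hfin.exists_le_maximal hp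
      obtain ⟨x, hx⟩ := hf q (hmax.mem_toFinset.mpr hq)
      have hinj := localizedForm_injective_of_notMem p (h p hp).2 fun hxp ↦ hx (hpq hxp)
      have h0 : LocalizedModule.mkLinearMap p.primeCompl M y = 0 := by
        rw [← map_eq_zero_iff _ hinj, localizedForm_mkLinearMap, hy, map_zero]
      obtain ⟨s, hs⟩ := (IsLocalizedModule.eq_zero_iff p.primeCompl _).mp h0
      exact s.2 (hle hs)
  exact (Submodule.mem_torsion_iff y).mpr ⟨⟨r, hreg⟩, hr⟩

end Noetherian

/-- for a semidualizing module `C` over a Noetherian ring `R`, the following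
are equivalent: `C` has rank 1; `C` has rank; `C` is isomorphic to an ideal of `R`;
`C` is isomorphic to an ideal `a` with `R/a` torsion. -/
theorem statement3
    (R : Type) [CommRing R] [IsNoetherianRing R]
    (C : Type) [AddCommGroup C] [Module R C] (hC : IsSemidualizing R C) :
    List.TFAE
      [∀ (p : Ideal R) [p.IsPrime], p ∈ associatedPrimes R R →
         Module.Free (Localization.AtPrime p) (LocalizedModule p.primeCompl C) ∧
         Module.finrank (Localization.AtPrime p) (LocalizedModule p.primeCompl C) = 1,
       ∀ (p : Ideal R) [p.IsPrime], p ∈ associatedPrimes R R →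
         Module.Free (Localization.AtPrime p) (LocalizedModule p.primeCompl C),
       ∃ a : Ideal R, Nonempty (C ≃ₗ[R] ↥a),
       ∃ a : Ideal R, Nonempty (C ≃ₗ[R] ↥a) ∧
         ∀ x : R ⧸ a, ∃ r ∈ nonZeroDivisors R, r • x = 0] := by
  obtain ⟨_, hhom, -⟩ := hC
  have := Module.finitePresentation_of_finite R C
  have : FaithfulSMul R C := ⟨fun h ↦ hhom.1 (LinearMap.ext h)⟩
  tfae_have 1 → 2 := fun h p _ hp ↦ (h p hp).1
  tfae_have 2 → 1 := fun h p _ hp ↦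
    have := h p hp
    ⟨this, finrank_localizedModule_eq_one hhom p⟩
  tfae_have 1 → 3 := fun h ↦ by
    obtain ⟨f, hf⟩ := exists_injective_linearForm (torsion_eq_bot_of_bijective_algebraMap hhom) h
    exact ⟨LinearMap.range f, ⟨LinearEquiv.ofInjective f hf⟩⟩
  tfae_have 3 → 4 := fun ⟨a, ⟨e⟩⟩ ↦ by
    obtain ⟨r, hra, hr⟩ := exists_mem_nonZeroDivisors_of_linearEquiv e
    refine ⟨a, ⟨e⟩, fun x ↦ ⟨r, hr, ?_⟩⟩
    obtain ⟨x, rfl⟩ := Ideal.Quotient.mk_surjective x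
    exact Ideal.Quotient.eq_zero_iff_mem.mpr (a.mul_mem_right x hra)
  tfae_have 4 → 1 := fun ⟨a, ⟨e⟩, h⟩ p _ hp ↦ by
    obtain ⟨r, hra, hr⟩ := exists_mem_nonZeroDivisors_of_linearEquiv e
    have hrp : r ∉ p := fun hrp ↦ by
      have hmem : r ∈ ⋃ p ∈ associatedPrimes R R, (p : Set R) := Set.mem_biUnion hp hrp
      rw [biUnion_associatedPrimes_eq_compl_nonZeroDivisors] at hmem
      exact hmem hr
    have hinj := localizedForm_injective p (f := a.subtype ∘ₗ e.toLinearMap)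
      (Subtype.val_injective.comp e.injective)
    have hsurj := localizedForm_surjective p (f := a.subtype ∘ₗ e.toLinearMap)
      (x := e.symm ⟨r, hra⟩) (by simpa using hrp)
    have E := LinearEquiv.ofBijective _ ⟨hinj, hsurj⟩
    exact ⟨Module.Free.of_equiv E.symm, E.finrank_eq.trans (Module.finrank_self _)⟩
  tfae_finish
end

section
/- Let R be a Cohen–Macaulay commutative Noetherian ring and let a be a proper ideal of R that is semidualizing as an R-module. Then Ext^1_R(R/a, a) ≅ R/a as R-modules, and Ext^i_R(R/a, a) = 0 for every integer i ≠ 1 (in particular Hom_R(R/a, a) = 0). -/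
open CategoryTheory

/-- A Cohen–Macaulay local ring: a Noetherian local ring admitting a regular sequence of
non-units whose length is the Krull dimension. -/
def IsCohenMacaulayLocalRing (R : Type) [CommRing R] : Prop :=
  IsNoetherianRing R ∧ IsLocalRing R ∧
  ∃ rs : List R, (∀ r ∈ rs, ¬IsUnit r) ∧ RingTheory.Sequence.IsRegular R rs ∧
    (rs.length : WithBot ℕ∞) = ringKrullDim R

/-- A Cohen–Macaulay ring: all localizations at primes are Cohen–Macaulay local rings. -/
def IsCohenMacaulayRing (R : Type) [CommRing R] : Prop :=
  IsNoetherianRing R ∧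
  ∀ (p : Ideal R) [p.IsPrime], IsCohenMacaulayLocalRing (Localization.AtPrime p)

/-- The height of an ideal: the infimum of the heights of primes containing it. -/
noncomputable def idealHeight (R : Type) [CommRing R] (I : Ideal R) : ℕ∞ :=
  ⨅ p ∈ {p : PrimeSpectrum R | I ≤ p.asIdeal}, Order.height p

namespace CategoryTheory.ProjectiveResolution

open Limits

variable {C : Type*} [Category* C] [Abelian C] {X : C}

/-- The augmentation map of a projective resolution. -/
noncomputable def augmentation (P : ProjectiveResolution X) : P.complex.X 0 ⟶ X :=
  P.π.f 0

instance (P : ProjectiveResolution X) : Epi P.augmentation :=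
  inferInstanceAs (Epi (P.π.f 0))

@[simp]
theorem d_comp_augmentation (P : ProjectiveResolution X) :
    P.complex.d 1 0 ≫ P.augmentation = 0 :=
  P.complex_d_comp_π_f_zero

@[simp]
theorem d_comp_augmentation_assoc (P : ProjectiveResolution X) {Y : C} (f : X ⟶ Y) :
    P.complex.d 1 0 ≫ P.augmentation ≫ f = 0 := by
  rw [← Category.assoc, d_comp_augmentation, zero_comp]

theorem exact_augmentation (P : ProjectiveResolution X) :
    (ShortComplex.mk _ _ P.d_comp_augmentation).Exact :=
  ShortComplex.exact_of_g_is_cokernel _ P.isColimitCokernelCofork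

/-- Splicing a projective resolution of the first term of a short exact sequence with a projective
middle term gives a projective resolution of the last term. -/
noncomputable def splice {S : ShortComplex C} (hS : S.ShortExact) [Projective S.X₂]
    (P : ProjectiveResolution S.X₁) : ProjectiveResolution S.X₃ where
  complex := P.complex.augment (P.augmentation ≫ S.f) (P.d_comp_augmentation_assoc S.f)
  projective
    | 0 => (inferInstance : Projective S.X₂)
    | n + 1 => P.projective n
  π := (ChainComplex.toSingle₀Equiv _ _).symm ⟨S.g,
    show (P.augmentation ≫ S.f) ≫ S.g = 0 by rw [Category.assoc, S.zero, comp_zero]⟩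
  quasiIso := ⟨fun n => by
    have hmono := hS.mono_f
    have hepi := hS.epi_g
    match n with
    | 0 =>
      rw [ChainComplex.quasiIsoAt₀_iff, ShortComplex.quasiIso_iff_of_zeros' _ rfl rfl rfl]
      let T : ShortComplex C := ShortComplex.mk (P.augmentation ≫ S.f) S.g (by simp)
      let α : T ⟶ S := { τ₁ := P.augmentation, τ₂ := 𝟙 _, τ₃ := 𝟙 _ }
      have : Epi α.τ₁ := inferInstanceAs (Epi P.augmentation)
      have hT : T.Exact := (ShortComplex.exact_iff_of_epi_of_isIso_of_mono α).2 hS.exact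
      refine (ShortComplex.exact_and_epi_g_iff_of_iso (S₂ := T) ?_).2 ⟨hT, hepi⟩
      exact ShortComplex.isoMk (Iso.refl _) (Iso.refl _) (Iso.refl _)
        ((Category.id_comp _).trans (Category.comp_id _).symm)
        (by
          refine (Category.id_comp _).trans (Eq.trans ?_ (Category.comp_id _).symm)
          exact (ChainComplex.toSingle₀Equiv_symm_apply_f_zero
            (C := P.complex.augment (P.augmentation ≫ S.f) _) S.g _).symm)
    | 1 =>
      rw [quasiIsoAt_iff_exactAt' _ _ (ChainComplex.exactAt_succ_single_obj _ _),
        HomologicalComplex.exactAt_iff' _ 2 1 0 (by simp) (by simp)]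
      let T : ShortComplex C :=
        ShortComplex.mk (P.complex.d 1 0) (P.augmentation ≫ S.f)
          (P.d_comp_augmentation_assoc S.f)
      let α : ShortComplex.mk _ _ P.d_comp_augmentation ⟶ T :=
        { τ₁ := 𝟙 _, τ₂ := 𝟙 _, τ₃ := S.f }
      have : Mono α.τ₃ := hmono
      exact (ShortComplex.exact_iff_of_epi_of_isIso_of_mono α).1 P.exact_augmentation
    | n + 2 =>
      rw [quasiIsoAt_iff_exactAt' _ _ (ChainComplex.exactAt_succ_single_obj _ _),
        HomologicalComplex.exactAt_iff' _ (n + 3) (n + 2) (n + 1) (by simp) (by simp)]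
      exact P.exact_succ n⟩

end CategoryTheory.ProjectiveResolution

section ExtModule

variable {R : Type} [CommRing R]

/-- An Ext module vanishes if and only if the corresponding Hom complex of a projective resolution
is exact. -/
theorem subsingleton_extModule_iff {M : ModuleCat.{0} R} (P : ProjectiveResolution M)
    (N : ModuleCat.{0} R) (i n : ℕ) (hi : (ComplexShape.up ℕ).prev n = i) :
    Subsingleton (ExtModule R M N n) ↔
      ∀ f : P.complex.X n ⟶ N, P.complex.d (n + 1) n ≫ f = 0 →
        ∃ g : P.complex.X i ⟶ N, P.complex.d n i ≫ g = f := by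
  rw [← ModuleCat.isZero_iff_subsingleton]
  rw [show Limits.IsZero (ExtModule R M N n) ↔ _ from (P.isoExt n N).isZero_iff,
    ← HomologicalComplex.exactAt_iff_isZero_homology,
    HomologicalComplex.exactAt_iff' _ i n (n + 1) hi (by simp),
    ShortComplex.moduleCat_exact_iff]
  rfl

variable {S : ShortComplex (ModuleCat.{0} R)} [Projective S.X₂]

/-- Dimension shifting for the vanishing of Ext in degrees at least two. -/
theorem subsingleton_extModule_add_two (hS : S.ShortExact) (N : ModuleCat.{0} R) (n : ℕ)
    (h : Subsingleton (ExtModule R S.X₁ N (n + 1))) :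
    Subsingleton (ExtModule R S.X₃ N (n + 2)) := by
  let P := ProjectiveResolution.of S.X₁
  rw [subsingleton_extModule_iff P N n (n + 1) (by simp)] at h
  rw [subsingleton_extModule_iff (P.splice hS) N (n + 1) (n + 2) (by simp)]
  exact h

theorem subsingleton_extModule_zero (hS : S.ShortExact) (N : ModuleCat.{0} R)
    (h : ∀ g : S.X₂ ⟶ N, S.f ≫ g = 0 → g = 0) :
    Subsingleton (ExtModule R S.X₃ N 0) := by
  let P := ProjectiveResolution.of S.X₁
  rw [subsingleton_extModule_iff (P.splice hS) N 0 0 (by simp)]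
  intro (f : S.X₂ ⟶ N) hf
  have hf' : (P.augmentation ≫ S.f) ≫ f = 0 := hf
  rw [Category.assoc] at hf'
  exact ⟨0, by rw [h f (Limits.zero_of_epi_comp P.augmentation hf'), Limits.comp_zero]; rfl⟩

/-- The first Ext module is the cokernel of the restriction map on Hom modules. -/
theorem nonempty_extModule_one_equiv (hS : S.ShortExact) (N : ModuleCat.{0} R) :
    Nonempty (ExtModule R S.X₃ N 1 ≃ₗ[R]
      (S.X₁ ⟶ N) ⧸ LinearMap.range (Linear.leftComp R N S.f)) := by
  let P := ProjectiveResolution.of S.X₁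
  let K := (P.splice hS).complex.linearYonedaObj R N
  let T := K.sc' 0 1 2
  let e : ExtModule R S.X₃ N 1 ≃ₗ[R] _ :=
    ((P.splice hS).isoExt 1 N ≪≫ K.homologyIsoSc' 0 1 2 (by simp) (by simp) ≪≫
      T.moduleCatHomologyIso).toLinearEquiv
  let c : (S.X₁ ⟶ N) →ₗ[R] LinearMap.ker T.g.hom :=
    (Linear.leftComp R N P.augmentation).codRestrict _
      P.d_comp_augmentation_assoc
  let φ := (LinearMap.range T.moduleCatToCycles).mkQ ∘ₗ c
  have hφ : Function.Surjective φ := by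
    refine (Submodule.mkQ_surjective _).comp ?_
    rintro ⟨f, hf⟩
    have hf' : P.complex.d 1 0 ≫ (f : P.complex.X 0 ⟶ N) = 0 := hf
    exact ⟨P.exact_augmentation.desc f hf', Subtype.ext (P.exact_augmentation.g_desc f hf')⟩
  have hker : LinearMap.ker φ = LinearMap.range (Linear.leftComp R N S.f) := by
    ext f
    rw [LinearMap.mem_ker, LinearMap.comp_apply, Submodule.mkQ_apply,
      Submodule.Quotient.mk_eq_zero]
    constructor
    · rintro ⟨(g : S.X₂ ⟶ N), hg⟩
      have hg' : (P.augmentation ≫ S.f) ≫ g = P.augmentation ≫ f :=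
        congrArg Subtype.val hg
      rw [Category.assoc, cancel_epi] at hg'
      exact ⟨g, hg'⟩
    · rintro ⟨g, rfl⟩
      exact ⟨g, Subtype.ext (Category.assoc P.augmentation S.f g)⟩
  exact ⟨e ≪≫ₗ (φ.quotKerEquivOfSurjective hφ).symm ≪≫ₗ Submodule.quotEquivOfEq _ _ hker⟩

end ExtModule

namespace Ideal

variable {R : Type} [CommRing R] (a : Ideal R)

/-- The short complex `a → R → R ⧸ a`. -/
def quotientShortComplex : ShortComplex (ModuleCat.{0} R) :=
  ShortComplex.moduleCatMk a.subtype a.mkQ (by ext x; exact (Submodule.Quotient.mk_eq_zero a).2 x.2)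

theorem quotientShortComplex_shortExact : a.quotientShortComplex.ShortExact where
  exact := (ShortComplex.ShortExact.moduleCat_exact_iff_function_exact _).2
    (LinearMap.exact_subtype_mkQ a)
  mono_f := (ModuleCat.mono_iff_injective _).2 a.injective_subtype
  epi_g := (ModuleCat.epi_iff_surjective _).2 a.mkQ_surjective

instance : Projective a.quotientShortComplex.X₂ :=
  (IsProjective.iff_projective (R := R) R).1 inferInstance

/-- Restricting a homomorphism `R → a` to `a` gives the homothety of its value at one. -/
theorem comp_subtype_eq_algebraMap (g : R →ₗ[R] a) :
    g ∘ₗ a.subtype = algebraMap R (Module.End R a) (g 1) := by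
  ext x
  have h := g.map_smul (x : R) 1
  rw [smul_eq_mul, mul_one] at h
  simp [h, mul_comm]

end Ideal

/-- for a proper semidualizing ideal `a` of a Cohen–Macaulay ring `R`,
`Ext^1_R(R/a, a) ≅ R/a` and `Ext^i_R(R/a, a) = 0` for `i ≠ 1`. -/
theorem statement5
    (R : Type) [CommRing R] (hCM : IsCohenMacaulayRing R)
    (a : Ideal R) (ha : a ≠ ⊤) (hsd : IsSemidualizing R ↥a) :
    Nonempty (↥(ExtModule R (ModuleCat.of R (R ⧸ a)) (ModuleCat.of R ↥a) 1) ≃ₗ[R] (R ⧸ a)) ∧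
    ∀ i : ℕ, i ≠ 1 →
      Subsingleton (ExtModule R (ModuleCat.of R (R ⧸ a)) (ModuleCat.of R ↥a) i) := by
  obtain ⟨-, hbij, hext⟩ := hsd
  have hS := a.quotientShortComplex_shortExact
  refine ⟨?_, fun i hi => ?_⟩
  · obtain ⟨e⟩ := nonempty_extModule_one_equiv hS (ModuleCat.of R a)
    let φ :=
      (LinearMap.range (Linear.leftComp R (ModuleCat.of R a) a.quotientShortComplex.f)).mkQ ∘ₗ
      (ModuleCat.homLinearEquiv (S := R) (M := ModuleCat.of R a)
        (N := ModuleCat.of R a)).symm.toLinearMap ∘ₗ (Algebra.linearMap R (Module.End R a))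
    have hφ : Function.Surjective φ :=
      (Submodule.mkQ_surjective _).comp <|
        (ModuleCat.homLinearEquiv (S := R)).symm.surjective.comp hbij.2
    have hker : LinearMap.ker φ = a := by
      ext r
      rw [LinearMap.mem_ker, LinearMap.comp_apply, Submodule.mkQ_apply,
        Submodule.Quotient.mk_eq_zero]
      constructor
      · rintro ⟨(g : ModuleCat.of R R ⟶ ModuleCat.of R a), hg⟩
        have hg' : g.hom ∘ₗ a.subtype = algebraMap R (Module.End R a) r :=
          congrArg ModuleCat.Hom.hom hg
        rw [a.comp_subtype_eq_algebraMap] at hg'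
        exact hbij.1 hg' ▸ Subtype.property _
      · intro hr
        refine ⟨ModuleCat.ofHom (LinearMap.toSpanSingleton R a ⟨r, hr⟩), ModuleCat.hom_ext ?_⟩
        exact (a.comp_subtype_eq_algebraMap _).trans
          (congrArg (fun x : a => algebraMap R (Module.End R a) x) (one_smul R _))
    exact ⟨e ≪≫ₗ (φ.quotKerEquivOfSurjective hφ).symm ≪≫ₗ Submodule.quotEquivOfEq _ _ hker⟩
  · match i, hi with
    | 0, _ =>
      refine subsingleton_extModule_zero hS _ fun (g : ModuleCat.of R R ⟶ ModuleCat.of R a) hg =>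
        ModuleCat.hom_ext ?_
      have hg' : g.hom ∘ₗ a.subtype = 0 := congrArg ModuleCat.Hom.hom hg
      rw [a.comp_subtype_eq_algebraMap, ← map_zero (algebraMap R (Module.End R a))] at hg'
      exact LinearMap.ext_ring (Subtype.ext (hbij.1 hg'))
    | n + 2, _ => exact subsingleton_extModule_add_two hS _ n (hext (n + 1) n.succ_pos)
end

section
/- Let (R,m) be a Cohen–Macaulay commutative Noetherian local ring and let a be a proper ideal of R that is semidualizing as an R-module. Then the ring R/a is Gorenstein if and only if a has finite injective dimension as an R-module (i.e., a is a dualizing module for R); moreover, if these equivalent conditions hold, then R_p is a Gorenstein local ring for every minimal prime p of R. -/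
open CategoryTheory

namespace CategoryTheory.Abelian.Ext

universe w v u

variable {C : Type u} [Category.{v} C] [Abelian C] [HasExt.{w} C]

/-- Dimension shifting along a short exact sequence with injective middle term. -/
lemma subsingleton_succ_iff_of_injective {S : ShortComplex C} (hS : S.ShortExact) [Injective S.X₂]
    (X : C) (i : ℕ) :
    Subsingleton (Ext X S.X₁ (i + 2)) ↔ Subsingleton (Ext X S.X₃ (i + 1)) := by
  constructor
  · intro h
    refine subsingleton_of_forall_eq 0 fun x ↦ ?_
    obtain ⟨y, rfl⟩ := Ext.covariant_sequence_exact₃ X hS x (n₁ := i + 2) rfl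
      (Subsingleton.elim _ _)
    rw [Ext.eq_zero_of_injective y, Ext.zero_comp]
  · intro h
    refine subsingleton_of_forall_eq 0 fun x ↦ ?_
    obtain ⟨y, rfl⟩ := Ext.covariant_sequence_exact₁ X hS x (Ext.eq_zero_of_injective _)
      (n₀ := i + 1) rfl
    rw [Subsingleton.elim y 0, Ext.zero_comp]

/-- For a short exact sequence with injective middle term, the first `Ext` measures the
obstruction to lifting morphisms along the epimorphism. -/
lemma subsingleton_one_iff_of_injective {S : ShortComplex C} (hS : S.ShortExact) [Injective S.X₂]
    (X : C) :
    Subsingleton (Ext X S.X₁ 1) ↔ ∀ f : X ⟶ S.X₃, ∃ g : X ⟶ S.X₂, g ≫ S.g = f := by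
  constructor
  · intro h f
    obtain ⟨y, hy⟩ := Ext.covariant_sequence_exact₃ X hS (Ext.mk₀ f) (n₁ := 1) rfl
      (Subsingleton.elim _ _)
    obtain ⟨g, rfl⟩ := (Ext.mk₀_bijective X S.X₂).2 y
    exact ⟨g, (Ext.mk₀_bijective X S.X₃).1 (by rw [← hy, Ext.mk₀_comp_mk₀])⟩
  · intro h
    refine subsingleton_of_forall_eq 0 fun x ↦ ?_
    obtain ⟨y, rfl⟩ := Ext.covariant_sequence_exact₁ X hS x (Ext.eq_zero_of_injective _)
      (n₀ := 0) rfl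
    obtain ⟨f, rfl⟩ := (Ext.mk₀_bijective X S.X₃).2 y
    obtain ⟨g, rfl⟩ := h f
    rw [← Ext.mk₀_comp_mk₀, Ext.comp_assoc_of_second_deg_zero, hS.comp_extClass, Ext.comp_zero]

lemma subsingleton_of_retract_right (X : C) {Y Y' : C} (h : Retract Y Y') (i : ℕ)
    (h' : Subsingleton (Ext X Y' i)) : Subsingleton (Ext X Y i) := by
  refine subsingleton_of_forall_eq 0 fun x ↦ ?_
  have : x = (x.comp (mk₀ h.i) (add_zero i)).comp (mk₀ h.r) (add_zero i) := by simp
  rw [this, Subsingleton.elim (x.comp (mk₀ h.i) (add_zero i)) 0, zero_comp]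

end CategoryTheory.Abelian.Ext

/-- In positive degrees, the derived functor `Ext` vanishes exactly when the `Ext` group of the
derived category does. -/
lemma subsingleton_extModule_succ_iff (R : Type) [CommRing R] (M N : ModuleCat.{0} R) (i : ℕ) :
    Subsingleton (ExtModule R M N (i + 1)) ↔ Subsingleton (Abelian.Ext M N (i + 1)) := by
  let P := ProjectiveResolution.of M
  have e := P.isoExt (i + 1) N (R := R)
  have h1 : Subsingleton (ExtModule R M N (i + 1)) ↔
      (P.complex.linearYonedaObj R N).ExactAt (i + 1) := by
    rw [HomologicalComplex.exactAt_iff_isZero_homology]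
    rw [← ModuleCat.isZero_iff_subsingleton]
    exact e.isZero_iff
  rw [h1, HomologicalComplex.exactAt_iff' _ i (i + 1) (i + 2) (by simp) (by simp),
    ShortComplex.moduleCat_exact_iff]
  constructor
  · intro h
    refine subsingleton_of_forall_eq 0 fun x ↦ ?_
    obtain ⟨f, hf, rfl⟩ := P.extMk_surjective x (i + 2) rfl
    rw [P.extMk_eq_zero_iff f _ rfl hf i rfl]
    exact h f hf
  · intro h f hf
    exact (P.extMk_eq_zero_iff f (i + 2) rfl hf i rfl).1 (Subsingleton.elim _ _)

/-- A module has injective dimension at most `n` as soon as `Ext^(n+1)` from all cyclic modules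
vanishes. -/
lemma hasInjectiveDimensionLE_of_subsingleton_ext_quotient {R : Type} [CommRing R]
    (M : ModuleCat.{0} R) (n : ℕ)
    (h : ∀ I : Ideal R, Subsingleton (Abelian.Ext (ModuleCat.of R (R ⧸ I)) M (n + 1))) :
    HasInjectiveDimensionLE M n := by
  induction n generalizing M with
  | zero =>
    have hB : Module.Baer R M := by
      intro I g
      have hS := ModuleCat.shortComplex_shortExact
        (ModuleCat.shortComplexOfCompEqZero I.subtype I.mkQ
          (LinearMap.exact_subtype_mkQ I).linearMap_comp_eq_zero)
        (LinearMap.exact_subtype_mkQ I) I.injective_subtype I.mkQ_surjective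
      have := h I
      obtain ⟨x, hx⟩ := Abelian.Ext.contravariant_sequence_exact₁ hS M
        (Abelian.Ext.mk₀ (ModuleCat.ofHom g)) (n₁ := 1) rfl
        (@Subsingleton.elim _ (h I) _ _)
      obtain ⟨f, rfl⟩ := (Abelian.Ext.mk₀_bijective _ M).2 x
      rw [Abelian.Ext.mk₀_comp_mk₀] at hx
      have hf := (Abelian.Ext.mk₀_bijective _ M).1 hx
      refine ⟨f.hom, fun x hxI ↦ ?_⟩
      exact LinearMap.congr_fun (congrArg ModuleCat.Hom.hom hf) ⟨x, hxI⟩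
    have : Injective M := Module.injective_object_of_injective_module R M (inj := hB.injective)
    infer_instance
  | succ n ih =>
    let S := ShortComplex.mk _ _ (Limits.cokernel.condition (Injective.ι M))
    have hS : S.ShortExact :=
      { exact := ShortComplex.exact_of_g_is_cokernel _ (Limits.cokernelIsCokernel S.f) }
    have : Injective S.X₂ := inferInstanceAs (Injective (Injective.under M))
    refine (hS.hasInjectiveDimensionLT_X₃_iff n this).1 (ih _ fun I ↦ ?_)
    exact (Abelian.Ext.subsingleton_succ_iff_of_injective hS _ n).1 (h I)

/-- For `J = (I : x)`, the exact sequence `0 → R/J → R/I → R/(I + x) → 0`. -/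
lemma exists_shortExact_quotient_colon {R : Type} [CommRing R] (I J : Ideal R) (x : R)
    (hJ : ∀ y, y ∈ J ↔ x * y ∈ I) :
    ∃ (f : (R ⧸ J) →ₗ[R] (R ⧸ I)) (g : (R ⧸ I) →ₗ[R] (R ⧸ (I ⊔ Ideal.span {x}))),
      (∀ y : R, f (Ideal.Quotient.mk J y) = Ideal.Quotient.mk I (x * y)) ∧
      Function.Injective f ∧ Function.Surjective g ∧ Function.Exact f g := by
  let f : (R ⧸ J) →ₗ[R] (R ⧸ I) := Submodule.mapQ J I (LinearMap.lsmul R R x)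
    (fun y hy ↦ by simpa using (hJ y).1 hy)
  let g : (R ⧸ I) →ₗ[R] (R ⧸ (I ⊔ Ideal.span {x})) := Submodule.factor le_sup_left
  refine ⟨f, g, fun y ↦ rfl, ?_, Submodule.factor_surjective _, ?_⟩
  · rw [injective_iff_map_eq_zero]
    intro y hy
    obtain ⟨y, rfl⟩ := Ideal.Quotient.mk_surjective y
    have : Ideal.Quotient.mk I (x * y) = 0 := hy
    rw [Ideal.Quotient.eq_zero_iff_mem] at this ⊢
    exact (hJ y).2 this
  · intro y
    obtain ⟨y, rfl⟩ := Ideal.Quotient.mk_surjective y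
    constructor
    · intro hy
      have hy : Ideal.Quotient.mk (I ⊔ Ideal.span {x}) y = 0 := hy
      rw [Ideal.Quotient.eq_zero_iff_mem] at hy
      obtain ⟨i, hi, z, hz, rfl⟩ := Submodule.mem_sup.1 hy
      obtain ⟨z, rfl⟩ := Ideal.mem_span_singleton'.1 hz
      refine ⟨Ideal.Quotient.mk J z, ?_⟩
      change Ideal.Quotient.mk I (x * z) = _
      rw [Ideal.Quotient.mk_eq_mk_iff_sub_mem, mul_comm]
      simpa using hi
    · rintro ⟨z, hz⟩
      obtain ⟨z, rfl⟩ := Ideal.Quotient.mk_surjective z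
      rw [← hz]
      change Ideal.Quotient.mk (I ⊔ Ideal.span {x}) (x * z) = 0
      rw [Ideal.Quotient.eq_zero_iff_mem]
      exact Ideal.mul_mem_right _ _ (Ideal.mem_sup_right (Ideal.mem_span_singleton_self x))

/-- Over a Noetherian local ring, vanishing of `Ext^j(k, M)` in all large degrees, for `k` the
residue field and `M` finitely generated, propagates to all cyclic modules. -/
lemma subsingleton_ext_quotient_of_residueField {R : Type} [CommRing R] [IsNoetherianRing R]
    [IsLocalRing R] (M : ModuleCat.{0} R) [Module.Finite R M] (n : ℕ)
    (h : ∀ j, n ≤ j →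
      Subsingleton (Abelian.Ext (ModuleCat.of R (R ⧸ IsLocalRing.maximalIdeal R)) M j))
    (I : Ideal R) :
    ∀ j, n ≤ j → Subsingleton (Abelian.Ext (ModuleCat.of R (R ⧸ I)) M j) := by
  induction I using WellFoundedGT.induction with
  | ind I ih =>
  intro j hj
  by_cases htop : I = ⊤
  · subst htop
    have hz : Limits.IsZero (ModuleCat.of R (R ⧸ (⊤ : Ideal R))) := by
      rw [ModuleCat.isZero_iff_subsingleton]
      exact Ideal.Quotient.subsingleton_iff.2 rfl
    exact subsingleton_of_forall_eq 0 fun x ↦ by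
      rw [← Abelian.Ext.mk₀_id_comp x, hz.eq_of_src (𝟙 _) 0, Abelian.Ext.mk₀_zero,
        Abelian.Ext.zero_comp]
  have hle := IsLocalRing.le_maximalIdeal htop
  rcases hle.eq_or_lt with rfl | hlt
  · exact h j hj
  obtain ⟨x, hxm, hxI⟩ := SetLike.exists_of_lt hlt
  have hI : I < I ⊔ Ideal.span {x} := by
    refine lt_of_le_of_ne le_sup_left fun he ↦ hxI ?_
    rw [he]
    exact Ideal.mem_sup_right (Ideal.mem_span_singleton_self x)
  let J : Ideal R := Submodule.comap (LinearMap.lsmul R R x) I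
  have hJ : ∀ y, y ∈ J ↔ x * y ∈ I := fun y ↦ Iff.rfl
  have hIJ : I ≤ J := fun y hy ↦ Ideal.mul_mem_left _ _ hy
  rcases hIJ.eq_or_lt with heq | hlt'
  · obtain ⟨f, g, hf, hfi, hgs, hfg⟩ := exists_shortExact_quotient_colon I I x (by
      intro y; conv_lhs => rw [heq]
      exact hJ y)
    have hS := ModuleCat.shortComplex_shortExact
        (ModuleCat.shortComplexOfCompEqZero f g hfg.linearMap_comp_eq_zero) hfg hfi hgs
    have hfx : ModuleCat.ofHom f = x • 𝟙 (ModuleCat.of R (R ⧸ I)) := by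
      refine ModuleCat.hom_ext (LinearMap.ext fun y ↦ ?_)
      obtain ⟨y, rfl⟩ := Ideal.Quotient.mk_surjective y
      exact hf y
    have hbot : (⊤ : Submodule R (Abelian.Ext (ModuleCat.of R (R ⧸ I)) M j)) = ⊥ := by
      refine Submodule.eq_bot_of_le_smul_of_le_jacobson_bot (IsLocalRing.maximalIdeal R) _
        Module.Finite.fg_top ?_ (IsLocalRing.maximalIdeal_le_jacobson _)
      intro z _
      have := ih _ hI (1 + j) (by lia)
      obtain ⟨w, rfl⟩ := Abelian.Ext.contravariant_sequence_exact₁ hS M z (n₁ := 1 + j) rfl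
        (@Subsingleton.elim _ this _ _)
      have : (Abelian.Ext.mk₀ (ModuleCat.ofHom f)).comp w (zero_add j) = x • w := by
        rw [hfx, Abelian.Ext.mk₀_smul, Abelian.Ext.smul_comp, Abelian.Ext.mk₀_id_comp]
      exact this ▸ Submodule.smul_mem_smul hxm trivial
    exact (Submodule.subsingleton_iff R).1 (subsingleton_of_bot_eq_top hbot.symm)
  · obtain ⟨f, g, hf, hfi, hgs, hfg⟩ := exists_shortExact_quotient_colon I J x hJ
    have hS := ModuleCat.shortComplex_shortExact
        (ModuleCat.shortComplexOfCompEqZero f g hfg.linearMap_comp_eq_zero) hfg hfi hgs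
    refine subsingleton_of_forall_eq 0 fun z ↦ ?_
    have h1 := ih _ hlt' j hj
    have h3 := ih _ hI j hj
    obtain ⟨w, rfl⟩ := Abelian.Ext.contravariant_sequence_exact₂ hS M z
      (@Subsingleton.elim _ h1 _ _)
    rw [@Subsingleton.elim _ h3 w 0, Abelian.Ext.comp_zero]

section ChangeOfRings

variable {R : Type} [CommRing R] (I : Ideal R)

lemma smul_eq_zero_of_mem_of_quotient_module {N : Type} [AddCommGroup N] [Module R N]
    [Module (R ⧸ I) N] [IsScalarTower R (R ⧸ I) N] {r : R} (hr : r ∈ I) (x : N) : r • x = 0 := by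
  rw [← algebraMap_smul (R ⧸ I) r x, Ideal.Quotient.algebraMap_eq,
    Ideal.Quotient.eq_zero_iff_mem.2 hr, zero_smul]

/-- A linear map out of an `R ⧸ I`-module lands in the `I`-torsion. -/
noncomputable def liftTorsion {N M : Type} [AddCommGroup N] [Module R N]
    [Module (R ⧸ I) N] [IsScalarTower R (R ⧸ I) N] [AddCommGroup M] [Module R M] (f : N →ₗ[R] M) :
    N →ₗ[R ⧸ I] Submodule.torsionBySet R M (I : Set R) :=
  LinearMap.extendScalarsOfSurjective (R := R) Ideal.Quotient.mk_surjective
    (f.codRestrict (Submodule.torsionBySet R M (I : Set R)) fun x ↦ by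
      rw [Submodule.mem_torsionBySet_iff]
      intro r
      rw [← map_smul, smul_eq_zero_of_mem_of_quotient_module I r.2, map_zero])

@[simp]
lemma coe_liftTorsion_apply {N M : Type} [AddCommGroup N] [Module R N]
    [Module (R ⧸ I) N] [IsScalarTower R (R ⧸ I) N] [AddCommGroup M] [Module R M] (f : N →ₗ[R] M)
    (x : N) : (liftTorsion I f x : M) = f x := rfl

/-- The functoriality of the `I`-torsion. -/
noncomputable def torsionMap {M N : Type} [AddCommGroup M] [Module R M] [AddCommGroup N]
    [Module R N] (f : M →ₗ[R] N) :
    Submodule.torsionBySet R M (I : Set R) →ₗ[R ⧸ I] Submodule.torsionBySet R N (I : Set R) :=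
  liftTorsion I (f ∘ₗ (Submodule.torsionBySet R M (I : Set R)).subtype)

@[simp]
lemma coe_torsionMap_apply {M N : Type} [AddCommGroup M] [Module R M] [AddCommGroup N]
    [Module R N] (f : M →ₗ[R] N) (x : Submodule.torsionBySet R M (I : Set R)) :
    (torsionMap I f x : N) = f x := rfl

/-- The `I`-torsion of an injective `R`-module is an injective `R ⧸ I`-module. -/
lemma injective_torsionBySet (M : Type) [AddCommGroup M] [Module R M] [Module.Injective R M] :
    Module.Injective (R ⧸ I) (Submodule.torsionBySet R M (I : Set R)) where
  out X Y _ _ _ _ f hf g := by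
    let := Module.compHom X (algebraMap R (R ⧸ I))
    let := Module.compHom Y (algebraMap R (R ⧸ I))
    have : IsScalarTower R (R ⧸ I) X := .of_algebraMap_smul fun _ _ ↦ rfl
    have : IsScalarTower R (R ⧸ I) Y := .of_algebraMap_smul fun _ _ ↦ rfl
    obtain ⟨h, hh⟩ := Module.Injective.out (f.restrictScalars R) hf
      ((Submodule.torsionBySet R M (I : Set R)).subtype ∘ₗ g.restrictScalars R)
    exact ⟨liftTorsion I h, fun x ↦ Subtype.ext (hh x)⟩

variable {M E Q : Type} [AddCommGroup M] [Module R M] [AddCommGroup E] [Module R E]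
  [AddCommGroup Q] [Module R Q] {f : M →ₗ[R] E} {g : E →ₗ[R] Q}

lemma exact_torsionMap (hf : Function.Injective f) (hfg : Function.Exact f g) :
    Function.Exact (torsionMap I f) (torsionMap I g) := by
  intro x
  constructor
  · intro hx
    obtain ⟨y, hy⟩ := (hfg x).1 (congrArg Subtype.val hx)
    refine ⟨⟨y, ?_⟩, Subtype.ext hy⟩
    rw [Submodule.mem_torsionBySet_iff]
    intro r
    apply hf
    rw [map_smul, hy, map_zero]
    exact (Submodule.mem_torsionBySet_iff _ _).1 x.2 r
  · rintro ⟨y, rfl⟩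
    exact Subtype.ext (hfg.apply_apply_eq_zero _)

lemma injective_torsionMap (hf : Function.Injective f) : Function.Injective (torsionMap I f) :=
  fun _ _ h ↦ Subtype.ext (hf (congrArg Subtype.val h))

lemma surjective_torsionMap
    (h : ∀ φ : (R ⧸ I) →ₗ[R] Q, ∃ ψ : (R ⧸ I) →ₗ[R] E, g ∘ₗ ψ = φ) :
    Function.Surjective (torsionMap I g) := by
  intro q
  obtain ⟨ψ, hψ⟩ := h ((Submodule.torsionBySet R Q (I : Set R)).subtype ∘ₗ
    (LinearMap.toSpanSingleton (R ⧸ I) _ q).restrictScalars R)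
  refine ⟨liftTorsion I ψ 1, Subtype.ext ?_⟩
  simpa using LinearMap.congr_fun hψ 1

lemma subsingleton_ext_one_iff_linearMap (N : Type) [AddCommGroup N] [Module R N]
    (hf : Function.Injective f) (hfg : Function.Exact f g) (hg : Function.Surjective g)
    [Module.Injective R E] :
    Subsingleton (Abelian.Ext (ModuleCat.of R N) (ModuleCat.of R M) 1) ↔
      ∀ φ : N →ₗ[R] Q, ∃ ψ : N →ₗ[R] E, g ∘ₗ ψ = φ := by
  let S := ModuleCat.shortComplexOfCompEqZero f g hfg.linearMap_comp_eq_zero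
  have hS : S.ShortExact := ModuleCat.shortComplex_shortExact S hfg hf hg
  have : Injective S.X₂ := Module.injective_object_of_injective_module R E
  refine (Abelian.Ext.subsingleton_one_iff_of_injective hS (ModuleCat.of R N)).trans ⟨?_, ?_⟩
  · intro h φ
    obtain ⟨ψ, hψ⟩ := h (ModuleCat.ofHom φ)
    exact ⟨ψ.hom, congrArg ModuleCat.Hom.hom hψ⟩
  · intro h φ
    obtain ⟨ψ, hψ⟩ := h φ.hom
    exact ⟨ModuleCat.ofHom ψ, ModuleCat.hom_ext hψ⟩

lemma subsingleton_ext_succ_iff_linearMap (N : Type) [AddCommGroup N] [Module R N]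
    (hf : Function.Injective f) (hfg : Function.Exact f g) (hg : Function.Surjective g)
    [Module.Injective R E] (i : ℕ) :
    Subsingleton (Abelian.Ext (ModuleCat.of R N) (ModuleCat.of R M) (i + 2)) ↔
      Subsingleton (Abelian.Ext (ModuleCat.of R N) (ModuleCat.of R Q) (i + 1)) := by
  let S := ModuleCat.shortComplexOfCompEqZero f g hfg.linearMap_comp_eq_zero
  have hS : S.ShortExact := ModuleCat.shortComplex_shortExact S hfg hf hg
  have : Injective S.X₂ := Module.injective_object_of_injective_module R E
  exact Abelian.Ext.subsingleton_succ_iff_of_injective hS (ModuleCat.of R N) i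

lemma exists_linearMap_injective (M : Type) [AddCommGroup M] [Module R M] :
    ∃ (E : Type) (_ : AddCommGroup E) (_ : Module R E) (f : M →ₗ[R] E),
      Module.Injective R E ∧ Function.Injective f := by
  let E := Injective.under (ModuleCat.of R M)
  refine ⟨E, inferInstance, inferInstance, (Injective.ι (ModuleCat.of R M)).hom, ?_, ?_⟩
  · have : Injective (ModuleCat.of R E) := inferInstanceAs (Injective E)
    exact Module.injective_module_of_injective_object R E
  · exact (ModuleCat.mono_iff_injective _).1 inferInstance

/-- Change of rings for `Ext`: if `Ext^j_R(R/I, M)` vanishes for all positive `j`, then the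
vanishing of `Ext_R(N, M)` and of `Ext_{R/I}(N, Hom_R(R/I, M))` are equivalent. -/
lemma subsingleton_ext_torsionBySet_iff (N : Type) [AddCommGroup N] [Module R N]
    [Module (R ⧸ I) N] [IsScalarTower R (R ⧸ I) N] (i : ℕ) (M : Type) [AddCommGroup M] [Module R M]
    (hM : ∀ j : ℕ, Subsingleton (Abelian.Ext (ModuleCat.of R (R ⧸ I)) (ModuleCat.of R M) (j + 1))) :
    Subsingleton (Abelian.Ext (ModuleCat.of (R ⧸ I) N)
      (ModuleCat.of (R ⧸ I) (Submodule.torsionBySet R M (I : Set R))) (i + 1)) ↔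
    Subsingleton (Abelian.Ext (ModuleCat.of R N) (ModuleCat.of R M) (i + 1)) := by
  induction i generalizing M with
  | zero =>
    obtain ⟨E, _, _, f, _, hf⟩ := exists_linearMap_injective (R := R) M
    have hfg := f.exact_map_mkQ_range
    have hg := f.range.mkQ_surjective
    have hs := surjective_torsionMap I ((subsingleton_ext_one_iff_linearMap _ hf hfg hg).1 (hM 0))
    have := injective_torsionBySet I E
    rw [subsingleton_ext_one_iff_linearMap _ hf hfg hg, subsingleton_ext_one_iff_linearMap _
      (injective_torsionMap I hf) (exact_torsionMap I hf hfg) hs]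
    constructor
    · intro h φ
      obtain ⟨ψ, hψ⟩ := h (liftTorsion I φ)
      refine ⟨(Submodule.torsionBySet R E (I : Set R)).subtype ∘ₗ ψ.restrictScalars R, ?_⟩
      ext x
      exact congrArg Subtype.val (LinearMap.congr_fun hψ x)
    · intro h φ
      obtain ⟨ψ, hψ⟩ := h ((Submodule.torsionBySet R _ (I : Set R)).subtype ∘ₗ φ.restrictScalars R)
      refine ⟨liftTorsion I ψ, ?_⟩
      ext x
      exact LinearMap.congr_fun hψ x
  | succ i ih =>
    obtain ⟨E, _, _, f, _, hf⟩ := exists_linearMap_injective (R := R) M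
    have hfg := f.exact_map_mkQ_range
    have hg := f.range.mkQ_surjective
    have hs := surjective_torsionMap I ((subsingleton_ext_one_iff_linearMap _ hf hfg hg).1 (hM 0))
    have := injective_torsionBySet I E
    rw [subsingleton_ext_succ_iff_linearMap _ hf hfg hg, subsingleton_ext_succ_iff_linearMap _
      (injective_torsionMap I hf) (exact_torsionMap I hf hfg) hs]
    exact ih _ fun j ↦ (subsingleton_ext_succ_iff_linearMap _ hf hfg hg j).1 (hM (j + 1))

end ChangeOfRings

lemma subsingleton_ext_iff_of_linearEquiv_prod {A : Type} [CommRing A] {N E P Q : Type}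
    [AddCommGroup N] [Module A N] [AddCommGroup E] [Module A E] [AddCommGroup P] [Module A P]
    [AddCommGroup Q] [Module A Q] [Module.Injective A E] (e : (E × P) ≃ₗ[A] Q) (i : ℕ) :
    Subsingleton (Abelian.Ext (ModuleCat.of A N) (ModuleCat.of A Q) (i + 1)) ↔
      Subsingleton (Abelian.Ext (ModuleCat.of A N) (ModuleCat.of A P) (i + 1)) := by
  let f : E →ₗ[A] Q := e.toLinearMap ∘ₗ LinearMap.inl A E P
  let g : Q →ₗ[A] P := LinearMap.snd A E P ∘ₗ e.symm.toLinearMap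
  let s : P →ₗ[A] Q := e.toLinearMap ∘ₗ LinearMap.inr A E P
  have hgs : g ∘ₗ s = LinearMap.id := by ext; simp [g, s]
  have hfg : Function.Exact f g := by
    intro x
    constructor
    · intro hx
      refine ⟨(e.symm x).1, ?_⟩
      have hx : (e.symm x).2 = 0 := hx
      have : ((e.symm x).1, (0 : P)) = e.symm x := by rw [← hx]
      change e ((e.symm x).1, (0 : P)) = x
      rw [this, e.apply_symm_apply]
    · rintro ⟨y, rfl⟩
      simp [f, g]
  have hf : Function.Injective f := e.injective.comp LinearMap.inl_injective
  have hg : Function.Surjective g :=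
    (LinearMap.snd_surjective (R := A) (M := E)).comp e.symm.surjective
  constructor
  · exact Abelian.Ext.subsingleton_of_retract_right _
      { i := ModuleCat.ofHom s
        r := ModuleCat.ofHom g
        retract := by rw [← ModuleCat.ofHom_comp, hgs]; rfl } _
  · intro h
    let S := ModuleCat.shortComplexOfCompEqZero f g hfg.linearMap_comp_eq_zero
    have hS : S.ShortExact := ModuleCat.shortComplex_shortExact S hfg hf hg
    have : Injective S.X₁ := Module.injective_object_of_injective_module A E
    refine subsingleton_of_forall_eq 0 fun x ↦ ?_
    obtain ⟨y, rfl⟩ := Abelian.Ext.covariant_sequence_exact₂ _ hS x (@Subsingleton.elim _ h _ _)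
    rw [Abelian.Ext.eq_zero_of_injective y, Abelian.Ext.zero_comp]

section SemidualizingIdeal

variable {R : Type} [CommRing R] {a : Ideal R}

lemma eq_zero_of_forall_mem_mul_eq_zero (ha : Function.Injective (algebraMap R (Module.End R a)))
    {r : R} (hr : ∀ s ∈ a, s * r = 0) : r = 0 := by
  refine ha ?_
  ext s
  simpa [Algebra.smul_def, mul_comm] using hr s s.2

/-- If the homothety map of the ideal `a` is bijective, then for any embedding of `a` into an
injective module `E`, the `a`-torsion of the cokernel is the direct sum of the
`a`-torsion of `E` and of `R ⧸ a`. -/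
lemma exists_torsionBySet_linearEquiv {E : Type} [AddCommGroup E] [Module R E]
    [Module.Injective R E] (ha : Function.Bijective (algebraMap R (Module.End R a)))
    {f : a →ₗ[R] E} (hf : Function.Injective f) :
    Nonempty ((Submodule.torsionBySet R E (a : Set R) × (R ⧸ a)) ≃ₗ[R ⧸ a]
      Submodule.torsionBySet R (E ⧸ f.range) (a : Set R)) := by
  obtain ⟨h, hh⟩ := Module.Injective.out a.subtype a.injective_subtype f
  have hx₀ : ∀ s : a, f s = (s : R) • h 1 := fun s ↦ by
    rw [← hh, ← map_smul]; simp
  let σ := liftTorsion a (a.mapQ f.range h fun s hs ↦ ⟨⟨s, hs⟩, (hh ⟨s, hs⟩).symm⟩)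
  have hσ : ∀ r : R, (σ (Ideal.Quotient.mk a r) : E ⧸ f.range) = f.range.mkQ (r • h 1) := by
    intro r
    rw [← map_smul, smul_eq_mul, mul_one]; rfl
  refine ⟨.ofBijective ((torsionMap a f.range.mkQ).coprod σ) ⟨?_, ?_⟩⟩
  · rw [injective_iff_map_eq_zero]
    rintro ⟨y, r⟩ hyr
    obtain ⟨r, rfl⟩ := Ideal.Quotient.mk_surjective r
    have hyr := congrArg Subtype.val hyr
    rw [LinearMap.coprod_apply, Submodule.coe_add, hσ, coe_torsionMap_apply, ← map_add,
      Submodule.coe_zero, Submodule.mkQ_apply, Submodule.Quotient.mk_eq_zero] at hyr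
    obtain ⟨b, hb⟩ := hyr
    have hrb : r = b := by
      refine sub_eq_zero.1 (eq_zero_of_forall_mem_mul_eq_zero ha.1 fun s hs ↦ ?_)
      have h1 : s • (y : E) = 0 := (Submodule.mem_torsionBySet_iff _ _).1 y.2 ⟨s, hs⟩
      have h2 : f (s • b) = f (r • ⟨s, hs⟩) := by
        rw [map_smul, hb, smul_add, h1, zero_add, map_smul, hx₀ ⟨s, hs⟩, smul_comm]
      have h3 := congrArg Subtype.val (hf h2)
      simp only [Submodule.coe_smul, smul_eq_mul] at h3
      rw [mul_sub, h3, mul_comm, sub_self]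
    have hr : Ideal.Quotient.mk a r = 0 := Ideal.Quotient.eq_zero_iff_mem.2 (hrb ▸ b.2)
    have hy : y = 0 := by
      refine Subtype.ext ?_
      rw [hx₀, hrb] at hb
      exact right_eq_add.1 hb
    rw [hr, hy]; rfl
  · rintro ⟨q, hq⟩
    obtain ⟨x, rfl⟩ := f.range.mkQ_surjective q
    have hx : ∀ s : a, ∃ b : a, f b = (s : R) • x := by
      intro s
      have := (Submodule.mem_torsionBySet_iff _ _).1 hq s
      rw [← map_smul, Submodule.mkQ_apply, Submodule.Quotient.mk_eq_zero] at this
      exact this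
    let φ : a →ₗ[R] a := (LinearEquiv.ofInjective f hf).symm.toLinearMap ∘ₗ
      ((LinearMap.toSpanSingleton R E x ∘ₗ a.subtype).codRestrict f.range fun s ↦ hx s)
    have hφ : ∀ s : a, f (φ s) = (s : R) • x := fun s ↦
      (LinearEquiv.ofInjective_symm_apply (h := hf) f _).trans rfl
    obtain ⟨r, hr⟩ := ha.2 φ
    refine ⟨(⟨x - r • h 1, ?_⟩, Ideal.Quotient.mk a r), Subtype.ext ?_⟩
    · rw [Submodule.mem_torsionBySet_iff]
      intro s
      have : φ s = r • s := by rw [← hr]; rfl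
      change (s : R) • (x - r • h 1) = 0
      rw [smul_sub, ← hφ, this, map_smul, hx₀, smul_comm, sub_self]
    · rw [LinearMap.coprod_apply, Submodule.coe_add, hσ, coe_torsionMap_apply, ← map_add,
        sub_add_cancel]

/-- For a semidualizing ideal `a` and an `R ⧸ a`-module `N`, the vanishing of
`Ext^(i+1)_{R/a}(N, R/a)` and of `Ext^(i+2)_R(N, a)` are equivalent. -/
lemma IsSemidualizing.subsingleton_ext_quotient_iff (hsd : IsSemidualizing R a) (N : Type)
    [AddCommGroup N] [Module R N] [Module (R ⧸ a) N] [IsScalarTower R (R ⧸ a) N] (i : ℕ) :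
    Subsingleton (Abelian.Ext (ModuleCat.of (R ⧸ a) N) (ModuleCat.of (R ⧸ a) (R ⧸ a)) (i + 1)) ↔
      Subsingleton (Abelian.Ext (ModuleCat.of R N) (ModuleCat.of R a) (i + 2)) := by
  obtain ⟨E, _, _, f, _, hf⟩ := exists_linearMap_injective (R := R) a
  have hfg := f.exact_map_mkQ_range
  have hg := f.range.mkQ_surjective
  obtain ⟨e⟩ := exists_torsionBySet_linearEquiv hsd.2.1 hf
  have := injective_torsionBySet a E
  rw [← subsingleton_ext_iff_of_linearEquiv_prod e, subsingleton_ext_succ_iff_linearMap N hf hfg hg]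
  refine subsingleton_ext_torsionBySet_iff a N i _ fun j ↦ ?_
  rw [← subsingleton_ext_succ_iff_linearMap _ hf hfg hg]
  have hS := ModuleCat.shortComplex_shortExact
    (ModuleCat.shortComplexOfCompEqZero a.subtype a.mkQ
      (LinearMap.exact_subtype_mkQ a).linearMap_comp_eq_zero)
    (LinearMap.exact_subtype_mkQ a) a.injective_subtype a.mkQ_surjective
  have h1 := (subsingleton_extModule_succ_iff R _ _ j).1 (hsd.2.2 (j + 1) j.succ_pos)
  have : Projective (ModuleCat.of R R) :=
    ModuleCat.projective_of_free (Module.Basis.singleton Unit R)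
  refine subsingleton_of_forall_eq 0 fun x ↦ ?_
  obtain ⟨y, rfl⟩ := Abelian.Ext.contravariant_sequence_exact₃ hS _ x
    (@Abelian.Ext.eq_zero_of_projective _ _ _ _ _ _ _ ‹_› _) (n₀ := j + 1) (by omega)
  rw [@Subsingleton.elim _ h1 y 0, Abelian.Ext.comp_zero]

end SemidualizingIdeal

lemma hasFiniteInjectiveDimension_iff {R : Type} [CommRing R] {M : Type} [AddCommGroup M]
    [Module R M] :
    HasFiniteInjectiveDimension R M ↔ ∃ n, HasInjectiveDimensionLE (ModuleCat.of R M) n := by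
  constructor
  · rintro ⟨n, hn⟩
    exact ⟨n, hasInjectiveDimensionLE_of_subsingleton_ext_quotient _ n fun I ↦
      (subsingleton_extModule_succ_iff R _ _ n).1 (hn _ _ n.lt_succ_self)⟩
  · rintro ⟨n, hn⟩
    refine ⟨n, fun N i hi ↦ ?_⟩
    obtain ⟨i, rfl⟩ := Nat.exists_eq_add_one_of_ne_zero (Nat.ne_zero_of_lt hi)
    exact (subsingleton_extModule_succ_iff R _ _ i).2
      (HasInjectiveDimensionLT.subsingleton _ (n + 1) _ hi N)

/-- An ideal meeting the multiplicative set `S` localizes to the whole ring. -/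
lemma Ideal.isLocalizedModule_of_mem {R : Type*} [CommRing R] (S : Submonoid R) (A : Type*)
    [CommRing A] [Algebra R A] [IsLocalization S A] (a : Ideal R) {t : R} (ht : t ∈ a)
    (htS : t ∈ S) : IsLocalizedModule S (Algebra.linearMap R A ∘ₗ a.subtype) where
  map_units := IsLocalizedModule.map_units (Algebra.linearMap R A)
  surj y := by
    obtain ⟨⟨r, s⟩, hrs⟩ := IsLocalizedModule.surj S (Algebra.linearMap R A) y
    refine ⟨(⟨t * r, a.mul_mem_right r ht⟩, ⟨t, htS⟩ * s), ?_⟩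
    change (⟨t, htS⟩ * s) • y = Algebra.linearMap R A (t • r)
    rw [map_smul, ← hrs, mul_smul]; rfl
  exists_of_eq {x y} h := by
    obtain ⟨c, hc⟩ := IsLocalizedModule.exists_of_eq (S := S) (f := Algebra.linearMap R A) h
    exact ⟨c, Subtype.ext hc⟩

lemma not_le_of_mem_minimalPrimes {R : Type} [CommRing R] [IsNoetherianRing R] {a : Ideal R}
    (ha : Function.Injective (algebraMap R (Module.End R a))) {p : Ideal R}
    (hp : p ∈ minimalPrimes R) : ¬ a ≤ p := by
  intro hap
  have hp' : p ∈ associatedPrimes R R := by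
    refine Module.associatedPrimes.minimalPrimes_annihilator_subset_associatedPrimes R R ?_
    rwa [Module.annihilator_eq_bot.2 inferInstance]
  obtain ⟨hprime, y, hy⟩ := isAssociatedPrime_iff.1 hp'
  refine hprime.ne_top ?_
  have hy0 : y = 0 := eq_zero_of_forall_mem_mul_eq_zero ha fun s hs ↦ by
    have := hap hs
    rwa [hy, Submodule.mem_colon_singleton, Submodule.mem_bot] at this
  rw [hy, hy0]
  simp

lemma ModuleCat.hasInjectiveDimensionLE_of_isLocalizedModule {R : Type} [CommRing R]
    [IsNoetherianRing R] (M : ModuleCat.{0} R) (n : ℕ) [HasInjectiveDimensionLE M n]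
    (S : Submonoid R) {N : Type} [AddCommGroup N] [Module R N] [Module (Localization S) N]
    [IsScalarTower R (Localization S) N] (f : M →ₗ[R] N) [IsLocalizedModule S f] :
    HasInjectiveDimensionLE (ModuleCat.of (Localization S) N) n := by
  let e := (IsLocalizedModule.linearEquiv S
    (M.localizedModuleMkLinearMap S) f).extendScalarsOfIsLocalization S (Localization S)
  have h := M.localizedModule_hasInjectiveDimensionLE n S
  exact (ModuleCat.hasInjectiveDimensionLE_iff_of_linearEquiv e n).1 h

lemma isGorensteinLocalRing_localization {R : Type} [CommRing R] [IsNoetherianRing R]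
    {a : Ideal R} (ha : HasFiniteInjectiveDimension R a) (p : Ideal R) [p.IsPrime]
    (hap : ¬ a ≤ p) : IsGorensteinLocalRing (Localization.AtPrime p) := by
  refine ⟨IsLocalization.isNoetherianRing p.primeCompl _ ‹_›, inferInstance,
    hasFiniteInjectiveDimension_iff.2 ?_⟩
  obtain ⟨n, hn⟩ := hasFiniteInjectiveDimension_iff.1 ha
  obtain ⟨t, hta, htp⟩ := SetLike.not_le_iff_exists.1 hap
  have := a.isLocalizedModule_of_mem p.primeCompl (Localization.AtPrime p) hta htp
  exact ⟨n, (ModuleCat.of R a).hasInjectiveDimensionLE_of_isLocalizedModule n p.primeCompl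
    (Algebra.linearMap R (Localization.AtPrime p) ∘ₗ a.subtype)⟩

lemma IsSemidualizing.hasFiniteInjectiveDimension_quotient {R : Type} [CommRing R] {a : Ideal R}
    (hsd : IsSemidualizing R a) (ha : HasFiniteInjectiveDimension R a) :
    HasFiniteInjectiveDimension (R ⧸ a) (R ⧸ a) := by
  obtain ⟨n, hn⟩ := ha
  refine ⟨n, fun N i hi ↦ ?_⟩
  obtain ⟨i, rfl⟩ := Nat.exists_eq_add_one_of_ne_zero (Nat.ne_zero_of_lt hi)
  let := Module.compHom N (algebraMap R (R ⧸ a))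
  have : IsScalarTower R (R ⧸ a) N := .of_algebraMap_smul fun _ _ ↦ rfl
  exact (subsingleton_extModule_succ_iff _ _ _ i).2 ((hsd.subsingleton_ext_quotient_iff N i).2
    ((subsingleton_extModule_succ_iff R _ _ (i + 1)).1 (hn _ _ (by omega))))

lemma IsSemidualizing.hasFiniteInjectiveDimension_of_quotient {R : Type} [CommRing R]
    [IsNoetherianRing R] [IsLocalRing R] {a : Ideal R} (hsd : IsSemidualizing R a) (ha : a ≠ ⊤)
    (h : HasFiniteInjectiveDimension (R ⧸ a) (R ⧸ a)) : HasFiniteInjectiveDimension R a := by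
  obtain ⟨n, hn⟩ := h
  have : Module.Finite R (ModuleCat.of R a) := hsd.1
  have hle := IsLocalRing.le_maximalIdeal ha
  let := Module.compHom (R ⧸ IsLocalRing.maximalIdeal R) (Ideal.Quotient.factor hle)
  have : IsScalarTower R (R ⧸ a) (R ⧸ IsLocalRing.maximalIdeal R) :=
    .of_algebraMap_smul fun r x ↦ (Algebra.smul_def r x).symm
  refine hasFiniteInjectiveDimension_iff.2 ⟨n + 2,
    hasInjectiveDimensionLE_of_subsingleton_ext_quotient _ _ fun I ↦
      subsingleton_ext_quotient_of_residueField _ (n + 2) (fun j hj ↦ ?_) I _ (by omega)⟩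
  obtain ⟨j, rfl⟩ := Nat.exists_eq_add_of_le' (le_of_add_le_right hj)
  exact (hsd.subsingleton_ext_quotient_iff _ j).1
    ((subsingleton_extModule_succ_iff _ _ _ j).1 (hn _ _ (by omega)))

/-- for a proper semidualizing ideal `a` of a Cohen–Macaulay local ring `R`,
the quotient `R/a` is Gorenstein iff `a` has finite injective dimension over `R` (i.e. `a`
is a dualizing module), and in that case `R` is generically Gorenstein. -/
theorem statement6
    (R : Type) [CommRing R] [IsLocalRing R] (hCM : IsCohenMacaulayLocalRing R)
    (a : Ideal R) (ha : a ≠ ⊤) (hsd : IsSemidualizing R ↥a) :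
    (IsGorensteinLocalRing (R ⧸ a) ↔ HasFiniteInjectiveDimension R ↥a) ∧
    (IsGorensteinLocalRing (R ⧸ a) →
      ∀ (p : Ideal R) [p.IsPrime], p ∈ minimalPrimes R →
        IsGorensteinLocalRing (Localization.AtPrime p)) := by
  have := hCM.1
  have := Ideal.Quotient.nontrivial_iff.2 ha
  have hiff : IsGorensteinLocalRing (R ⧸ a) ↔ HasFiniteInjectiveDimension R ↥a :=
    ⟨fun h ↦ hsd.hasFiniteInjectiveDimension_of_quotient ha h.2.2, fun h ↦
      ⟨inferInstance, .of_surjective' _ Ideal.Quotient.mk_surjective,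
        hsd.hasFiniteInjectiveDimension_quotient h⟩⟩
  exact ⟨hiff, fun h p _ hp ↦ isGorensteinLocalRing_localization (hiff.1 h) p
    (not_le_of_mem_minimalPrimes hsd.2.1.1 hp)⟩
end

section
/- Let R be a commutative Noetherian ring and let a and b be ideals of R that are semidualizing as R-modules, and suppose that the R-module a ⊗_R b is also semidualizing. Then the natural multiplication map a ⊗_R b → ab (sending x ⊗ y to xy) is an isomorphism of R-modules. -/
open CategoryTheory

open scoped TensorProduct

/-- Over a Noetherian ring, an ideal with zero annihilator contains a nonzerodivisor. -/
theorem Ideal.exists_mem_isSMulRegular_of_annihilator_eq_bot {R : Type*} [CommRing R]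
    [IsNoetherianRing R] {I : Ideal R} (hI : ∀ r : R, (∀ x ∈ I, r * x = 0) → r = 0) :
    ∃ x ∈ I, IsSMulRegular R x := by
  have : Subsingleton ((R ⧸ I) →ₗ[R] R) := by
    refine subsingleton_of_forall_eq 0 fun f ↦ ?_
    refine Submodule.linearMap_qext _ (LinearMap.ext_ring (hI _ fun x hx ↦ ?_))
    have hx0 : x • (Submodule.Quotient.mk 1 : R ⧸ I) = 0 := by
      rw [← Submodule.Quotient.mk_smul]
      exact (Submodule.Quotient.mk_eq_zero I).2 (by simpa using hx)
    have := congrArg f hx0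
    rw [map_smul, map_zero, smul_eq_mul, mul_comm] at this
    exact this
  obtain ⟨x, hx, hreg⟩ := IsSMulRegular.subsingleton_linearMap_iff.1 this
  exact ⟨x, by rwa [Ideal.annihilator_quotient] at hx, hreg⟩

/-- If every endomorphism of a finite module `M` over a Noetherian ring is a unique homothety,
then every nonzerodivisor of the ring is regular on `M`. -/
theorem IsSMulRegular.of_bijective_algebraMap_end {R M : Type*} [CommRing R] [IsNoetherianRing R]
    [AddCommGroup M] [Module R M] [Module.Finite R M]
    (h : Function.Bijective (algebraMap R (Module.End R M))) {r : R} (hr : IsSMulRegular R r) :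
    IsSMulRegular M r := by
  let N : Submodule R M := LinearMap.ker (LinearMap.lsmul R M r)
  have hN : Subsingleton (M →ₗ[R] N) := by
    refine subsingleton_of_forall_eq 0 fun f ↦ ?_
    obtain ⟨c, hc⟩ := h.2 (N.subtype ∘ₗ f)
    have hrc : r • c = 0 := h.1 <| by
      ext m
      rw [smul_eq_mul, map_mul, hc, map_zero]
      exact (f m).2
    obtain rfl : c = 0 := hr (by simpa using hrc)
    ext m
    simpa using (LinearMap.congr_fun hc m).symm
  obtain ⟨s, hs, hreg⟩ := IsSMulRegular.subsingleton_linearMap_iff.1 hN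
  obtain rfl : s = 0 := h.1 <| by
    ext m
    simpa using Module.mem_annihilator.1 hs m
  refine (isSMulRegular_iff_right_eq_zero_of_smul).2 fun m hm ↦ ?_
  exact congrArg Subtype.val (hreg (by simp) : (⟨m, hm⟩ : N) = 0)

/-- Products of elements of `a` and `b` act on `a ⊗ b` through the multiplication map. -/
theorem Ideal.mul_smul_eq_mulMap'_smul_tmul {R : Type*} [CommRing R] {a b : Ideal R} (x : a) (y : b)
    (t : a ⊗[R] b) :
    ((x : R) * (y : R)) • t = (Submodule.mulMap' a b t : R) • (x ⊗ₜ[R] y) := by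
  induction t with
  | zero => simp
  | add s t hs ht => simp [smul_add, add_smul, hs, ht]
  | tmul u v =>
    have hu : (x : R) • u = (u : R) • x := Subtype.ext (mul_comm _ _)
    have hv : (y : R) • v = (v : R) • y := Subtype.ext (mul_comm _ _)
    rw [← TensorProduct.smul_tmul_smul, hu, hv, TensorProduct.smul_tmul_smul,
      Submodule.val_mulMap'_tmul]

/-- A semidualizing ideal of a Noetherian ring contains a nonzerodivisor. -/
theorem IsSemidualizing.exists_mem_isSMulRegular {R : Type} [CommRing R] [IsNoetherianRing R]
    {a : Ideal R} (ha : IsSemidualizing R a) : ∃ x ∈ a, IsSMulRegular R x := by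
  refine Ideal.exists_mem_isSMulRegular_of_annihilator_eq_bot fun r hr ↦ ha.2.1.1 ?_
  ext x
  simpa using hr x x.2

/-- if `a`, `b` and `a ⊗_R b` are semidualizing, then the multiplication map
`a ⊗_R b → ab` is an isomorphism. -/
theorem statement7
    (R : Type) [CommRing R] [IsNoetherianRing R]
    (a b : Ideal R) (hsa : IsSemidualizing R ↥a) (hsb : IsSemidualizing R ↥b)
    (hsab : IsSemidualizing R (TensorProduct R ↥a ↥b)) :
    Function.Bijective (Submodule.mulMap' a b) := by
  refine ⟨(injective_iff_map_eq_zero _).2 fun t ht ↦ ?_, Submodule.mulMap'_surjective a b⟩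
  obtain ⟨x, hx, hxr⟩ := hsa.exists_mem_isSMulRegular
  obtain ⟨y, hy, hyr⟩ := hsb.exists_mem_isSMulRegular
  have := hsab.1
  refine (IsSMulRegular.of_bijective_algebraMap_end hsab.2.1 (hxr.mul hyr)).right_eq_zero_of_smul ?_
  simpa [ht] using Ideal.mul_smul_eq_mulMap'_smul_tmul (⟨x, hx⟩ : a) (⟨y, hy⟩ : b) t
end

section
/- Let R be a normal domain and C a semidualizing R-module. Then C is a reflexive R-module of rank 1; that is, the natural biduality map C → Hom_R(Hom_R(C,R),R) is bijective and C ⊗_R Frac(R) is a one-dimensional vector space over the fraction field Frac(R). -/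
open CategoryTheory

/-- A linear map whose values lie in the range of an injective linear map factors through it. -/
theorem exists_comp_eq_of_range_le {R M Y E : Type*} [CommRing R] [AddCommGroup M] [Module R M]
    [AddCommGroup Y] [Module R Y] [AddCommGroup E] [Module R E] {i : Y →ₗ[R] E}
    (hi : Function.Injective i) (f : M →ₗ[R] E) (hf : ∀ v, f v ∈ Set.range i) :
    ∃ k : M →ₗ[R] Y, ∀ v, i (k v) = f v :=
  ⟨LinearMap.codRestrictOfInjective f i hi hf, fun v ↦
    LinearMap.codRestrictOfInjective_comp_apply f i hi hf v⟩

/-- If `Ext¹(C, Y)` vanishes and `0 → Y → E → Q → 0` is exact, then every map `C → Q` lifts to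
`E`. -/
theorem exists_comp_eq_of_subsingleton_extModule_one {R : Type} [CommRing R]
    {C Y E Q : Type} [AddCommGroup C] [Module R C] [AddCommGroup Y] [Module R Y]
    [AddCommGroup E] [Module R E] [AddCommGroup Q] [Module R Q]
    (h : Subsingleton (ExtModule R (ModuleCat.of R C) (ModuleCat.of R Y) 1))
    (i : Y →ₗ[R] E) (π : E →ₗ[R] Q) (hi : Function.Injective i)
    (hπ : Function.Surjective π) (hex : Function.Exact i π) (g : C →ₗ[R] Q) :
    ∃ φ : C →ₗ[R] E, π ∘ₗ φ = g := by
  let P := projectiveResolution (ModuleCat.of R C)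
  have hz : ((P.complex.linearYonedaObj R (ModuleCat.of R Y)).ExactAt 1) := by
    rw [HomologicalComplex.exactAt_iff_isZero_homology]
    refine Limits.IsZero.of_iso ?_ (P.isoExt (R := R) 1 (ModuleCat.of R Y)).symm
    exact ModuleCat.isZero_of_iff_subsingleton.mpr h
  rw [HomologicalComplex.exactAt_iff' _ 0 1 2 (by simp) (by simp),
    ShortComplex.moduleCat_exact_iff] at hz
  have hcocycle : ∀ k : P.complex.X 1 ⟶ ModuleCat.of R Y, P.complex.d 2 1 ≫ k = 0 →
      ∃ l : P.complex.X 0 ⟶ ModuleCat.of R Y, P.complex.d 1 0 ≫ l = k :=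
    fun k hk ↦ hz k hk
  let ε : P.complex.X 0 ⟶ ModuleCat.of R C := P.π.f 0
  have hε : Function.Surjective ε := (ModuleCat.epi_iff_surjective _).mp
    (inferInstanceAs (Epi (P.π.f 0)))
  have hexε : ∀ y : P.complex.X 0, ε y = 0 → ∃ w, P.complex.d 1 0 w = y :=
    (ShortComplex.moduleCat_exact_iff _).mp P.exact₀
  have hdε : P.complex.d 1 0 ≫ ε = 0 := P.complex_d_comp_π_f_zero
  have : Module.Projective R (P.complex.X 0) :=
    (IsProjective.iff_projective _).mpr (inferInstanceAs (Projective (P.complex.X 0)))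
  obtain ⟨u, hu⟩ := Module.projective_lifting_property π (g ∘ₗ ε.hom) hπ
  have hcu : ∀ v, π (u v) = g (ε v) := fun v ↦ congr($hu v)
  have hεd : ∀ v, ε (P.complex.d 1 0 v) = 0 := fun v ↦ congr($(hdε).hom v)
  obtain ⟨k, hk⟩ := exists_comp_eq_of_range_le hi (u ∘ₗ (P.complex.d 1 0).hom) fun v ↦
    (hex _).mp (by simp [hcu, hεd])
  obtain ⟨l, hl⟩ := hcocycle (ModuleCat.ofHom k) (by
    ext v
    apply hi
    have hdd : P.complex.d 1 0 (P.complex.d 2 1 v) = 0 := congr($(P.complex.d_comp_d 2 1 0).hom v)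
    simpa [hdd] using hk (P.complex.d 2 1 v))
  have hker : LinearMap.ker ε.hom ≤ LinearMap.ker (u - i ∘ₗ l.hom) := fun y hy ↦ by
    obtain ⟨w, rfl⟩ := hexε y hy
    have hlw : l (P.complex.d 1 0 w) = k w := congr($(hl).hom w)
    simp [hlw, hk]
  refine ⟨(LinearMap.ker ε.hom).liftQ _ hker ∘ₗ
    (ε.hom.quotKerEquivOfSurjective hε).symm.toLinearMap, LinearMap.ext fun c ↦ ?_⟩
  obtain ⟨y, rfl⟩ := hε c
  have hy : (ε.hom.quotKerEquivOfSurjective hε).symm (ε y) = Submodule.Quotient.mk y :=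
    (LinearEquiv.symm_apply_eq _).mpr rfl
  simp [hy, hcu, hex.apply_apply_eq_zero]

/-- A finite faithful module over a Noetherian ring has a nonzero map to every nontrivial finite
module. -/
theorem exists_linearMap_ne_zero {R C M : Type*} [CommRing R] [IsNoetherianRing R]
    [AddCommGroup C] [Module R C] [Module.Finite R C] [AddCommGroup M] [Module R M]
    [Module.Finite R M] [Nontrivial M] (hC : Function.Injective (algebraMap R (Module.End R C))) :
    ∃ f : C →ₗ[R] M, f ≠ 0 := by
  by_contra! h
  have : Subsingleton (C →ₗ[R] M) := subsingleton_of_forall_eq 0 h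
  obtain ⟨r, hr, hreg⟩ := IsSMulRegular.subsingleton_linearMap_iff.mp this
  have hr0 : r = 0 := hC (LinearMap.ext fun c ↦ by
    simpa [Module.algebraMap_end_apply] using Module.mem_annihilator.mp hr c)
  subst hr0
  obtain ⟨m, hm⟩ := exists_ne (0 : M)
  exact hm (hreg (by simp))

/-- Every element of the submodule spanned by `m` is killed by the scalars killing `m`. -/
theorem smul_eq_zero_of_mem_span_singleton {R M : Type*} [CommRing R] [AddCommGroup M] [Module R M]
    {m v : M} {r : R} (hr : r • m = 0) (hv : v ∈ Submodule.span R {m}) : r • v = 0 := by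
  obtain ⟨s, rfl⟩ := Submodule.mem_span_singleton.mp hv
  rw [smul_comm, hr, smul_zero]

section HomothetyBijective

variable {R C : Type*} [CommRing R] [IsDomain R] [AddCommGroup C] [Module R C]
  (hC : Function.Bijective (algebraMap R (Module.End R C)))

include hC

/-- Over a Noetherian domain, a finite module whose homothety map is bijective is torsion-free. -/
theorem isTorsionFree_of_bijective_algebraMap_end [IsNoetherianRing R] [Module.Finite R C] :
    Module.IsTorsionFree R C := by
  rw [Module.isTorsionFree_iff_smul_eq_zero]
  intro t c htc
  by_contra! h
  obtain ⟨ht, hc⟩ := h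
  have : Nontrivial (Submodule.span R {c}) := by
    rw [Submodule.nontrivial_iff_ne_bot]
    simpa using hc
  obtain ⟨f, hf⟩ := exists_linearMap_ne_zero (M := Submodule.span R {c}) hC.1
  obtain ⟨r, hr⟩ := hC.2 ((Submodule.span R {c}).subtype ∘ₗ f)
  have hrv : ∀ v, r • v = f v := fun v ↦ congr($hr v)
  have hrt : t * r = 0 := hC.1 (LinearMap.ext fun v ↦ by
    simpa [Module.algebraMap_end_apply, mul_smul, hrv] using
      smul_eq_zero_of_mem_span_singleton htc (f v).2)
  have hr0 : r = 0 := (mul_eq_zero.mp hrt).resolve_left ht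
  exact hf (LinearMap.ext fun v ↦ Subtype.ext (by simp [← hrv, hr0]))

variable [Module.IsTorsionFree R C]

/-- For a torsion-free module with only scalar endomorphisms, functionals satisfy the rank-one
identity `f x • a = f a • x`. -/
theorem dual_apply_smul_comm (f : Module.Dual R C) (x a : C) : f x • a = f a • x := by
  obtain ⟨r, hr⟩ := hC.2 (f.smulRight a)
  have hrv : ∀ v, r • v = f v • a := fun v ↦ congr($hr v)
  by_cases ha : a = 0
  · simp [ha]
  · rw [← smul_left_injective R ha (hrv a), hrv]

/-- A nonzero functional on a torsion-free module with only scalar endomorphisms is injective. -/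
theorem dual_injective_of_ne_zero {f : Module.Dual R C} (hf : f ≠ 0) : Function.Injective f := by
  rw [injective_iff_map_eq_zero]
  intro a ha
  obtain ⟨x, hx⟩ := DFunLike.ne_iff.mp hf
  have h := dual_apply_smul_comm hC f x a
  rw [ha, zero_smul] at h
  exact (smul_eq_zero.mp h).resolve_left hx

/-- Functionals on a torsion-free module with only scalar endomorphisms are pairwise
proportional. -/
theorem dual_apply_mul_dual_comm (f g : Module.Dual R C) (x a : C) :
    f a * g x = f x * g a := by
  simpa using congr(g $(dual_apply_smul_comm hC f a x))

/-- A finite torsion-free module with only scalar endomorphisms and a nonzero functional has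
rank one. -/
theorem finrank_eq_one_of_dual_ne_zero [Module.Finite R C] {f : Module.Dual R C} (hf : f ≠ 0) :
    Module.finrank R C = 1 := by
  apply le_antisymm
  · simpa using LinearMap.finrank_le_finrank_of_injective (dual_injective_of_ne_zero hC hf)
  · obtain ⟨x, hx⟩ := DFunLike.ne_iff.mp hf
    have : Nontrivial C := ⟨x, 0, fun h ↦ hx (by simp [h])⟩
    exact Module.finrank_pos

end HomothetyBijective

/-- If `x ≠ 0` and `r` multiplies the image of every functional on `C` into `(x)`, then `x`
divides `r`, provided `R` is a normal domain and `C` has a nonzero functional. -/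
theorem dvd_of_forall_dvd_mul_dual {R C : Type*} [CommRing R] [IsDomain R] [IsNoetherianRing R]
    [IsIntegrallyClosed R] [AddCommGroup C] [Module R C] {f₀ : Module.Dual R C} {a₀ : C}
    (h₀ : f₀ a₀ ≠ 0) {x r : R} (hx : x ≠ 0)
    (h : ∀ (f : Module.Dual R C) (v : C), x ∣ r * f v) : x ∣ r := by
  let K := FractionRing R
  let N : Submodule R K :=
    (LinearMap.range (Module.Dual.eval R C a₀)).map (Algebra.linearMap R K)
  have hxK : algebraMap R K x ≠ 0 := by simpa using hx
  have hxi : Function.Injective (LinearMap.lsmul R R x) := fun a b hab ↦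
    mul_left_cancel₀ hx hab
  have hN : N ≠ ⊥ := by
    rw [Submodule.ne_bot_iff]
    exact ⟨algebraMap R K (f₀ a₀), ⟨_, ⟨f₀, rfl⟩, rfl⟩, by simpa using h₀⟩
  have hz : IsIntegral R (algebraMap R K r / algebraMap R K x) := by
    refine isIntegral_of_smul_mem_submodule N hN
      (Submodule.FG.map _ (IsNoetherian.noetherian _)) _ ?_
    rintro _ ⟨_, ⟨f, rfl⟩, rfl⟩
    obtain ⟨f', hf'⟩ := exists_comp_eq_of_range_le hxi (r • f) fun v ↦ by
      obtain ⟨t, ht⟩ := h f v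
      exact ⟨t, ht.symm⟩
    refine ⟨_, ⟨f', rfl⟩, ?_⟩
    have hfa : x * f' a₀ = r * f a₀ := hf' a₀
    have hfK := congr(algebraMap R K $hfa)
    rw [map_mul, map_mul] at hfK
    simp only [Algebra.linearMap_apply, Module.Dual.eval_apply, smul_eq_mul]
    rw [div_mul_eq_mul_div, eq_div_iff hxK, mul_comm, hfK]
  obtain ⟨q, hq⟩ := IsIntegrallyClosed.isIntegral_iff.mp hz
  refine ⟨q, IsFractionRing.injective R K ?_⟩
  rw [map_mul, hq, mul_div_cancel₀ _ hxK]

/-- A torsion-free module `C` with only scalar endomorphisms such that `Ext¹(C, C) = 0` has, for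
`x ≠ 0`, only scalar homomorphisms to `C ⧸ x C`. -/
theorem exists_forall_eq_mk_smul {R C : Type} [CommRing R] [IsDomain R] [AddCommGroup C]
    [Module R C] [Module.IsTorsionFree R C]
    (hC : Function.Bijective (algebraMap R (Module.End R C)))
    (hExt : Subsingleton (ExtModule R (ModuleCat.of R C) (ModuleCat.of R C) 1))
    {x : R} (hx : x ≠ 0) (h : C →ₗ[R] C ⧸ LinearMap.range (LinearMap.lsmul R C x)) :
    ∃ r : R, ∀ v, h v = Submodule.Quotient.mk (r • v) := by
  obtain ⟨φ, rfl⟩ := exists_comp_eq_of_subsingleton_extModule_one hExt (LinearMap.lsmul R C x)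
    (LinearMap.range (LinearMap.lsmul R C x)).mkQ (smul_right_injective C hx)
    (Submodule.mkQ_surjective _) (LinearMap.exact_map_mkQ_range _) h
  obtain ⟨r, rfl⟩ := hC.2 φ
  exact ⟨r, fun _ ↦ rfl⟩

/-- Over a normal domain, a finite torsion-free module `C` with only scalar endomorphisms such that
`Ext¹(C, C) = 0` is reflexive, provided it has a nonzero functional. -/
theorem isReflexive_of_subsingleton_extModule_one {R C : Type} [CommRing R] [IsDomain R]
    [IsNoetherianRing R] [IsIntegrallyClosed R] [AddCommGroup C] [Module R C] [Module.Finite R C]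
    [Module.IsTorsionFree R C] (hC : Function.Bijective (algebraMap R (Module.End R C)))
    (hExt : Subsingleton (ExtModule R (ModuleCat.of R C) (ModuleCat.of R C) 1))
    {f₀ : Module.Dual R C} (hf₀ : f₀ ≠ 0) : Module.IsReflexive R C := by
  have hinj : Function.Injective (Module.Dual.eval R C) := fun a b hab ↦
    dual_injective_of_ne_zero hC hf₀ congr($hab f₀)
  refine ⟨hinj, fun ψ ↦ ?_⟩
  obtain ⟨a₀, h₀⟩ := DFunLike.ne_iff.mp hf₀
  replace h₀ : f₀ a₀ ≠ 0 := h₀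
  have htrace : ∀ (f : Module.Dual R C) (a : C), f a • ψ = Module.Dual.eval R C (ψ f • a) := by
    intro f a
    ext g
    have hfg : f a • g = g a • f := LinearMap.ext fun v ↦ by
      simpa [mul_comm] using dual_apply_mul_dual_comm hC f g v a
    simpa [mul_comm] using congr(ψ $hfg)
  set x := f₀ a₀
  set c := ψ f₀ • a₀
  have hψ : x • ψ = Module.Dual.eval R C c := htrace f₀ a₀
  let Q := C ⧸ LinearMap.range (LinearMap.lsmul R C x)
  let m : Q := Submodule.Quotient.mk c
  by_cases hm : m = 0
  · obtain ⟨v, hv⟩ := (Submodule.Quotient.mk_eq_zero _).mp hm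
    refine ⟨v, smul_right_injective _ h₀ ?_⟩
    change x • _ = x • ψ
    rw [hψ, ← hv, LinearMap.lsmul_apply, map_smul]
  exfalso
  have : Nontrivial (Submodule.span R {m}) := by
    rw [Submodule.nontrivial_iff_ne_bot]
    simpa using hm
  obtain ⟨h, hh⟩ := exists_linearMap_ne_zero (M := Submodule.span R {m}) hC.1
  obtain ⟨r, hr⟩ := exists_forall_eq_mk_smul hC hExt h₀ ((Submodule.span R {m}).subtype ∘ₗ h)
  have hdvd : x ∣ r := by
    refine dvd_of_forall_dvd_mul_dual h₀ h₀ fun f v ↦ ?_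
    have hfm : f v • m = 0 := by
      refine (Submodule.Quotient.mk_eq_zero _).mpr ⟨ψ f • v, hinj ?_⟩
      rw [LinearMap.lsmul_apply, map_smul, ← htrace, smul_comm, hψ]
      exact (map_smul _ _ _).symm
    obtain ⟨k, hk⟩ := exists_comp_eq_of_range_le (i := LinearMap.lsmul R C x)
      (smul_right_injective C h₀) (LinearMap.lsmul R C (r * f v)) fun w ↦ by
        refine LinearMap.mem_range.mp ((Submodule.Quotient.mk_eq_zero _).mp ?_)
        have hw := smul_eq_zero_of_mem_span_singleton hfm (h w).2
        have hrw : (h w : Q) = Submodule.Quotient.mk (r • w) := hr w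
        rw [hrw, ← Submodule.Quotient.mk_smul, smul_smul, mul_comm] at hw
        exact hw
    obtain ⟨t, rfl⟩ := hC.2 k
    refine ⟨t, hC.1 (LinearMap.ext fun w ↦ ?_)⟩
    have := hk w
    simp only [LinearMap.lsmul_apply, Module.algebraMap_end_apply] at this ⊢
    rw [← this, mul_smul]
  obtain ⟨q, rfl⟩ := hdvd
  refine hh (LinearMap.ext fun v ↦ Subtype.ext ((hr v).trans ?_))
  exact (Submodule.Quotient.mk_eq_zero _).mpr ⟨q • v, by simp [mul_smul, smul_comm q x]⟩

/-- over a normal domain, every semidualizing module is reflexive of rank 1. -/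
theorem statement8
    (R : Type) [CommRing R] [IsDomain R] [IsNoetherianRing R] [IsIntegrallyClosed R]
    (C : Type) [AddCommGroup C] [Module R C] (hC : IsSemidualizing R C) :
    Module.IsReflexive R C ∧
    Module.finrank (FractionRing R) (TensorProduct R (FractionRing R) C) = 1 := by
  obtain ⟨hfin, hbij, hExt⟩ := hC
  have := isTorsionFree_of_bijective_algebraMap_end hbij
  obtain ⟨f, hf⟩ := exists_linearMap_ne_zero (M := R) hbij.1
  refine ⟨isReflexive_of_subsingleton_extModule_one hbij (hExt 1 one_pos) hf, ?_⟩
  rw [(TensorProduct.isBaseChange R C (FractionRing R)).finrank_eq,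
    finrank_eq_one_of_dual_ne_zero hbij hf]
end

section
/- Let R be a normal domain with only finitely many isomorphism classes of reflexive R-modules M such that M ⊗_R Frac(R) is one-dimensional over Frac(R). Then R has only finitely many isomorphism classes of semidualizing R-modules. -/
open CategoryTheory

namespace CategoryTheory.ShortComplex.ShortExact

universe w v u

/-- If `Ext¹(M, S.X₁)` vanishes, then morphisms from `M` lift along the epimorphism of the short
exact sequence `S`. -/
theorem exists_comp_eq_of_subsingleton_ext
    {R : Type u} [CommRing R] {𝒞 : Type v} [Category.{w} 𝒞] [Abelian 𝒞] [Linear R 𝒞]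
    [EnoughProjectives 𝒞] {S : ShortComplex 𝒞} (hS : S.ShortExact) (M : 𝒞)
    (hext : Subsingleton (((Ext R 𝒞 1).obj (Opposite.op M)).obj S.X₁)) (g : M ⟶ S.X₃) :
    ∃ G : M ⟶ S.X₂, G ≫ S.g = g := by
  have := hS.mono_f
  have := hS.epi_g
  let P := projectiveResolution M
  have hlift (u : P.complex.X 1 ⟶ S.X₁) (hu : P.complex.d 2 1 ≫ u = 0) :
      ∃ v : P.complex.X 0 ⟶ S.X₁, P.complex.d 1 0 ≫ v = u := by
    have h0 : Limits.IsZero ((P.complex.linearYonedaObj R S.X₁).homology 1) :=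
      (ModuleCat.isZero_of_subsingleton _).of_iso (P.isoExt 1 S.X₁).symm
    rw [← HomologicalComplex.exactAt_iff_isZero_homology,
      HomologicalComplex.exactAt_iff' _ 0 1 2 (by simp) (by simp),
      ShortComplex.moduleCat_exact_iff] at h0
    exact h0 u hu
  let π : P.complex.X 0 ⟶ M := P.π.f 0
  have hπ : P.complex.d 1 0 ≫ π = 0 := P.complex_d_comp_π_f_zero
  have : Epi π := inferInstanceAs (Epi (P.π.f 0))
  let u₀ := Projective.factorThru (π ≫ g) S.g
  have hu₀ : u₀ ≫ S.g = π ≫ g := Projective.factorThru_comp _ _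
  let u₁ := hS.exact.lift (P.complex.d 1 0 ≫ u₀) (by
    rw [Category.assoc, hu₀, reassoc_of% hπ, Limits.zero_comp])
  have hu₁ : u₁ ≫ S.f = P.complex.d 1 0 ≫ u₀ := hS.exact.lift_f _ _
  obtain ⟨v, hv⟩ := hlift u₁ (by
    rw [← cancel_mono S.f, Category.assoc, hu₁, P.complex.d_comp_d_assoc, Limits.zero_comp,
      Limits.zero_comp])
  obtain ⟨G, hG⟩ : ∃ G : M ⟶ S.X₂, π ≫ G = u₀ - v ≫ S.f :=
    ⟨_, (Limits.CokernelCofork.IsColimit.desc' P.isColimitCokernelCofork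
      (u₀ - v ≫ S.f) (by rw [Preadditive.comp_sub, ← hu₁, reassoc_of% hv, sub_self])).2⟩
  refine ⟨G, ?_⟩
  rw [← cancel_epi π, reassoc_of% hG, Preadditive.sub_comp, Category.assoc, S.zero,
    Limits.comp_zero, sub_zero, hu₀]

end CategoryTheory.ShortComplex.ShortExact

/-- If `Ext¹(M, N)` vanishes, then linear maps from `M` lift along a surjection with kernel `N`. -/
theorem LinearMap.exists_comp_eq_of_subsingleton_ext.{u} {R M N A B : Type u} [CommRing R]
    [AddCommGroup M] [AddCommGroup N] [AddCommGroup A] [AddCommGroup B] [Module R M] [Module R N]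
    [Module R A] [Module R B] {f : N →ₗ[R] A} {p : A →ₗ[R] B} (hf : Function.Injective f)
    (hp : Function.Surjective p) (hfp : Function.Exact f p)
    (hext : Subsingleton (((Ext R (ModuleCat.{u} R) 1).obj (Opposite.op (.of R M))).obj (.of R N)))
    (g : M →ₗ[R] B) : ∃ G : M →ₗ[R] A, p ∘ₗ G = g := by
  let S : ShortComplex (ModuleCat.{u} R) :=
    .mk (ModuleCat.ofHom f) (ModuleCat.ofHom p) (by ext n; exact hfp.apply_apply_eq_zero n)
  have hS : S.ShortExact :=
    { exact := (ShortComplex.ShortExact.moduleCat_exact_iff_function_exact S).mpr hfp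
      mono_f := (ModuleCat.mono_iff_injective _).mpr hf
      epi_g := (ModuleCat.epi_iff_surjective _).mpr hp }
  obtain ⟨G, hG⟩ := hS.exists_comp_eq_of_subsingleton_ext (R := R) (.of R M) hext
    (ModuleCat.ofHom g)
  exact ⟨G.hom, congr($(hG).hom)⟩

/-- A linear map whose values lie in the range of an injective linear map factors through it. -/
theorem LinearMap.exists_comp_eq_of_injective {R M A B : Type*} [Ring R] [AddCommGroup M]
    [AddCommGroup A] [AddCommGroup B] [Module R M] [Module R A] [Module R B] {i : A →ₗ[R] B}
    (hi : Function.Injective i) (g : M →ₗ[R] B) (hg : ∀ m, g m ∈ LinearMap.range i) :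
    ∃ g' : M →ₗ[R] A, i ∘ₗ g' = g := by
  refine ⟨(LinearEquiv.ofInjective i hi).symm.toLinearMap ∘ₗ g.codRestrict _ hg, ?_⟩
  ext m
  exact congr_arg Subtype.val ((LinearEquiv.ofInjective i hi).apply_symm_apply ⟨g m, hg m⟩)

/-- A linear map whose values are all divisible by `x` is `x` times a linear map, provided `x` is
regular on the target. -/
theorem LinearMap.exists_eq_smul {R M N : Type*} [CommRing R] [AddCommGroup M] [AddCommGroup N]
    [Module R M] [Module R N] {x : R} (hx : IsSMulRegular N x) (g : M →ₗ[R] N)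
    (hg : ∀ m, ∃ n, g m = x • n) : ∃ g' : M →ₗ[R] N, g = x • g' := by
  obtain ⟨g', hg'⟩ := LinearMap.exists_comp_eq_of_injective (i := LinearMap.lsmul R N x) hx g
    fun m => (hg m).imp fun n hn => hn.symm
  exact ⟨g', hg'.symm⟩

/-- A finite faithful module has a nonzero map to `R ⧸ p` for every prime `p`. -/
theorem Module.Finite.exists_linearMap_quotient_ne_zero {R C : Type*} [CommRing R]
    [AddCommGroup C] [Module R C] [Module.Finite R C] (hC : Module.annihilator R C = ⊥)
    (p : Ideal R) [hp : p.IsPrime] : ∃ h : C →ₗ[R] R ⧸ p, h ≠ 0 := by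
  have hmem : (⟨p, hp⟩ : PrimeSpectrum R) ∈ Module.support R C := by
    rw [Module.support_eq_zeroLocus, hC]
    simp
  rw [Module.mem_support_iff_nontrivial_residueField_tensorProduct] at hmem
  dsimp only at hmem
  let κ := p.ResidueField
  obtain ⟨v, hv⟩ := exists_ne (0 : TensorProduct R κ C)
  obtain ⟨l, hl⟩ := Module.Projective.exists_dual_ne_zero κ hv
  let ψ : C →ₗ[R] κ := l.restrictScalars R ∘ₗ TensorProduct.mk R κ C 1
  have hψ : ψ ≠ 0 := by
    intro h
    suffices hl0 : l = 0 from hl (by rw [hl0, LinearMap.zero_apply])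
    ext c
    exact congr($h c)
  let i : R ⧸ p →ₗ[R] κ := (IsScalarTower.toAlgHom R (R ⧸ p) κ).toLinearMap
  have hi : Function.Injective i := IsFractionRing.injective (R ⧸ p) κ
  obtain ⟨s, hs⟩ := Module.Finite.fg_top (R := R) (M := C)
  classical
  obtain ⟨⟨b, hb⟩, hbs⟩ := IsLocalization.exist_integer_multiples_of_finset
    (nonZeroDivisors (R ⧸ p)) (s.image ψ)
  obtain ⟨b, rfl⟩ := Ideal.Quotient.mk_surjective b
  obtain ⟨h, hh⟩ := LinearMap.exists_comp_eq_of_injective hi (b • ψ) fun m => by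
    suffices h : ⊤ ≤ (LinearMap.range i).comap (b • ψ) from h Submodule.mem_top
    rw [← hs, Submodule.span_le]
    intro c hc
    obtain ⟨z, hz⟩ := hbs (ψ c) (Finset.mem_image_of_mem _ hc)
    refine ⟨z, hz.trans ?_⟩
    exact (algebraMap_smul (R ⧸ p) b (ψ c))
  refine ⟨h, ?_⟩
  rintro rfl
  refine hψ (LinearMap.ext fun c => ?_)
  have hc : (Ideal.Quotient.mk p b) • ψ c = 0 := by
    rw [← Ideal.Quotient.algebraMap_eq, algebraMap_smul]
    simpa using congr($hh.symm c)
  rw [Algebra.smul_def] at hc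
  refine (mul_eq_zero.mp hc).resolve_left ?_
  simpa using nonZeroDivisors.ne_zero hb

section EndomorphismRing

variable {R C : Type*} [CommRing R] [AddCommGroup C] [Module R C]

theorem Module.annihilator_eq_bot_of_injective_algebraMap_end
    (hC : Function.Injective (algebraMap R (Module.End R C))) : Module.annihilator R C = ⊥ := by
  rw [eq_bot_iff]
  intro r hr
  refine hC ?_
  ext c
  simpa using Module.mem_annihilator.mp hr c

theorem Module.exists_forall_apply_eq_smul
    (hC : Function.Surjective (algebraMap R (Module.End R C))) (g : C →ₗ[R] C) :
    ∃ r : R, ∀ c, g c = r • c := by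
  obtain ⟨r, rfl⟩ := hC g
  exact ⟨r, fun c => rfl⟩

theorem isSMulRegular_of_bijective_algebraMap_end [IsDomain R] [IsNoetherianRing R]
    [Module.Finite R C] (hC : Function.Bijective (algebraMap R (Module.End R C)))
    {x : R} (hx : x ≠ 0) : IsSMulRegular C x := by
  rw [isSMulRegular_iff_right_eq_zero_of_smul]
  intro c hc
  by_contra hc0
  obtain ⟨p, hp, hle⟩ := exists_le_isAssociatedPrime_of_isNoetherianRing R c hc0
  obtain ⟨hprime, y, hy⟩ := isAssociatedPrime_iff.mp hp
  have hxp : x ∈ p := hle (by simpa [Submodule.mem_colon_singleton] using hc)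
  have hyp (r : R) : r ∈ p ↔ r • y = 0 := by
    rw [hy, Submodule.mem_colon_singleton, Submodule.mem_bot]
  obtain ⟨h, hh⟩ := Module.Finite.exists_linearMap_quotient_ne_zero
    (Module.annihilator_eq_bot_of_injective_algebraMap_end hC.1) p
  let k : R ⧸ p →ₗ[R] C := p.liftQ (LinearMap.toSpanSingleton R C y) fun r hr => by
    simpa using (hyp r).mp hr
  have hk : Function.Injective k := by
    rw [← LinearMap.ker_eq_bot, LinearMap.ker_eq_bot']
    intro q hq
    obtain ⟨r, rfl⟩ := Submodule.Quotient.mk_surjective _ q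
    exact (Submodule.Quotient.mk_eq_zero _).mpr ((hyp r).mpr (by simpa using (Submodule.liftQ_apply p _ r).symm.trans hq))
  obtain ⟨r, hr⟩ := Module.exists_forall_apply_eq_smul hC.2 (k ∘ₗ h)
  have hxh (q : R ⧸ p) : x • q = 0 := by
    obtain ⟨s, rfl⟩ := Submodule.Quotient.mk_surjective _ q
    rw [← Submodule.Quotient.mk_smul]
    exact (Submodule.Quotient.mk_eq_zero _).mpr (p.mul_mem_right _ hxp)
  have hxr : x * r = 0 := by
    have : x * r ∈ Module.annihilator R C := Module.mem_annihilator.mpr fun c => by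
      rw [mul_smul, ← hr, LinearMap.comp_apply, ← map_smul, hxh, map_zero]
    rwa [Module.annihilator_eq_bot_of_injective_algebraMap_end hC.1] at this
  obtain rfl := (mul_eq_zero.mp hxr).resolve_left hx
  refine hh (LinearMap.ext fun c => hk ?_)
  simpa using hr c

/-- If all endomorphisms of `C` are scalars, then `c ↦ φ c • a` is multiplication by `φ a`. -/
theorem Module.apply_smul_eq_apply_smul [IsDomain R]
    (hC : Function.Surjective (algebraMap R (Module.End R C))) (φ : C →ₗ[R] R) (a : C)
    (ha : φ a ≠ 0) (c : C) : φ c • a = φ a • c := by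
  obtain ⟨r, hr⟩ := Module.exists_forall_apply_eq_smul hC (φ.smulRight a)
  have hra : φ a = r := by
    have := congr(φ $(hr a))
    simp only [LinearMap.smulRight_apply, map_smul, smul_eq_mul] at this
    exact mul_right_cancel₀ ha this
  rw [hra, ← hr, LinearMap.smulRight_apply]

/-- Elements of the bidual are, up to the scalar `φ a`, evaluations at elements of `C`. -/
theorem Module.smul_eq_dual_eval [IsDomain R]
    (hC : Function.Surjective (algebraMap R (Module.End R C))) (φ : C →ₗ[R] R)
    (a : C) (ha : φ a ≠ 0) (ξ : Module.Dual R (Module.Dual R C)) :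
    φ a • ξ = Module.Dual.eval R C (ξ φ • a) := by
  ext ψ
  have h : φ a • ψ = ψ a • φ := by
    ext c
    have := congr(ψ $(Module.apply_smul_eq_apply_smul hC φ a ha c))
    simp only [map_smul, smul_eq_mul] at this
    simp only [LinearMap.smul_apply, smul_eq_mul, ← this, mul_comm]
  have := congr(ξ $h)
  simp only [map_smul, smul_eq_mul] at this
  simp [this, mul_comm]

/-- Suppose `r / x ∉ R` and `(r / x) p ⊆ R`. Over an integrally closed Noetherian domain, any
module with a nonzero functional then has a functional whose image is not contained in `p`. -/
theorem exists_apply_notMem_of_dvd [IsDomain R] [IsNoetherianRing R] [IsIntegrallyClosed R]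
    {p : Ideal R} {x r : R} (hx : x ≠ 0) (hxr : ¬ x ∣ r) (hp : ∀ y ∈ p, x ∣ r * y)
    {φ : C →ₗ[R] R} (hφ : φ ≠ 0) : ∃ (ψ : C →ₗ[R] R) (a : C), ψ a ∉ p := by
  by_contra! hall
  let K := FractionRing R
  let T : Ideal R := Ideal.span {y | ∃ (ψ : C →ₗ[R] R) (a : C), ψ a = y}
  let N : Submodule R K := Submodule.map (Algebra.linearMap R K) T
  have hinj : Function.Injective (algebraMap R K) := IsFractionRing.injective R K
  have hx' : algebraMap R K x ≠ 0 := by simpa using hx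
  have hT (n : R) (hn : n ∈ T) : ∃ m ∈ T, r * n = x * m := by
    induction hn using Submodule.span_induction with
    | mem y hy =>
      obtain ⟨ψ, a, rfl⟩ := hy
      obtain ⟨ψ', hψ'⟩ := LinearMap.exists_eq_smul (x := x) (IsSMulRegular.of_ne_zero hx) (r • ψ)
        fun c => by simpa [dvd_def] using hp _ (hall ψ c)
      exact ⟨ψ' a, Ideal.subset_span ⟨ψ', a, rfl⟩, by simpa using congr($hψ' a)⟩
    | zero => exact ⟨0, T.zero_mem, by simp⟩
    | add y z _ _ hy hz =>
      obtain ⟨m, hm, hm'⟩ := hy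
      obtain ⟨l, hl, hl'⟩ := hz
      exact ⟨m + l, T.add_mem hm hl, by rw [mul_add, mul_add, hm', hl']⟩
    | smul s y _ hy =>
      obtain ⟨m, hm, hm'⟩ := hy
      exact ⟨s * m, T.mul_mem_left s hm, by rw [smul_eq_mul, mul_left_comm, hm', mul_left_comm]⟩
  obtain ⟨a, ha⟩ : ∃ a, φ a ≠ 0 := by
    by_contra! h
    exact hφ (LinearMap.ext h)
  have hN : N ≠ ⊥ := by
    rw [Submodule.ne_bot_iff]
    exact ⟨algebraMap R K (φ a), ⟨φ a, Ideal.subset_span ⟨φ, a, rfl⟩, rfl⟩, by simpa using ha⟩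
  have hint : IsIntegral R (algebraMap R K r / algebraMap R K x) := by
    refine isIntegral_of_smul_mem_submodule N hN ((IsNoetherian.noetherian T).map _) _ ?_
    rintro _ ⟨n, hn, rfl⟩
    obtain ⟨m, hm, hnm⟩ := hT n hn
    refine ⟨m, hm, ?_⟩
    simp only [Algebra.linearMap_apply, smul_eq_mul]
    rw [div_mul_eq_mul_div, eq_div_iff hx', ← map_mul, ← map_mul, hnm, mul_comm]
  obtain ⟨z, hz⟩ := IsIntegrallyClosed.isIntegral_iff.mp hint
  refine hxr ⟨z, hinj ?_⟩
  rw [map_mul, hz, mul_div_cancel₀ _ hx']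

end EndomorphismRing

section Semidualizing

variable {R C : Type*} [CommRing R] [IsDomain R] [AddCommGroup C] [Module R C] [Module.Finite R C]

theorem Module.exists_dual_ne_zero_of_bijective_algebraMap_end
    (hC : Function.Bijective (algebraMap R (Module.End R C))) : ∃ φ : C →ₗ[R] R, φ ≠ 0 := by
  obtain ⟨h, hh⟩ := Module.Finite.exists_linearMap_quotient_ne_zero
    (Module.annihilator_eq_bot_of_injective_algebraMap_end hC.1) ⊥
  refine ⟨(Submodule.quotEquivOfEqBot ⊥ rfl).toLinearMap ∘ₗ h, fun h0 => hh ?_⟩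
  ext c
  simpa using congr($h0 c)

theorem Module.exists_dual_apply_ne_zero_of_bijective_algebraMap_end
    (hC : Function.Bijective (algebraMap R (Module.End R C))) :
    ∃ (φ : C →ₗ[R] R) (a : C), φ a ≠ 0 := by
  obtain ⟨φ, hφ⟩ := Module.exists_dual_ne_zero_of_bijective_algebraMap_end hC
  by_contra! h
  exact hφ (LinearMap.ext (h φ))

theorem Module.finrank_eq_one_of_bijective_algebraMap_end
    (hC : Function.Bijective (algebraMap R (Module.End R C))) :
    Module.finrank (FractionRing R) (TensorProduct R (FractionRing R) C) = 1 := by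
  obtain ⟨φ, a, ha⟩ := Module.exists_dual_apply_ne_zero_of_bijective_algebraMap_end hC
  have ha' : algebraMap R (FractionRing R) (φ a) ≠ 0 := by simpa using ha
  refine finrank_eq_one_iff'.mpr ⟨1 ⊗ₜ[R] a, fun h => ha' ?_, fun w => ?_⟩
  · have := congr(TensorProduct.rid R (FractionRing R) (φ.lTensor (FractionRing R) $h))
    simpa [Algebra.smul_def] using this
  · induction w using TensorProduct.induction_on with
    | zero => exact ⟨0, zero_smul _ _⟩
    | tmul k c =>
      refine ⟨k * algebraMap R _ (φ c) / algebraMap R _ (φ a), ?_⟩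
      rw [TensorProduct.smul_tmul', smul_eq_mul, mul_one]
      have h1 : k * algebraMap R (FractionRing R) (φ c) / algebraMap R _ (φ a) =
        φ c • (k / algebraMap R _ (φ a)) := by rw [Algebra.smul_def]; ring
      have h2 : k = φ a • (k / algebraMap R _ (φ a)) := by
        rw [Algebra.smul_def]
        field_simp
      rw [h1, TensorProduct.smul_tmul, Module.apply_smul_eq_apply_smul hC.2 φ a ha,
        ← TensorProduct.smul_tmul, ← h2]
    | add y z hy hz =>
      obtain ⟨k, rfl⟩ := hy
      obtain ⟨l, rfl⟩ := hz
      exact ⟨k + l, add_smul _ _ _⟩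

variable [IsNoetherianRing R]

theorem Module.injective_dual_eval_of_bijective_algebraMap_end
    (hC : Function.Bijective (algebraMap R (Module.End R C))) :
    Function.Injective (Module.Dual.eval R C) := by
  obtain ⟨φ, a, ha⟩ := Module.exists_dual_apply_ne_zero_of_bijective_algebraMap_end hC
  rw [injective_iff_map_eq_zero]
  intro c hc
  have hφc : φ c = 0 := congr($hc φ)
  have hac : φ a • c = 0 := by rw [← Module.apply_smul_eq_apply_smul hC.2 φ a ha, hφc, zero_smul]
  exact (isSMulRegular_of_bijective_algebraMap_end hC ha).right_eq_zero_of_smul hac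

/-- If `c₀ ∉ x C` has annihilator `p` modulo `x C` and every map `C → C / x C` lifts to `C`, then
some `r ∉ x R` satisfies `r p ⊆ x R`. -/
theorem exists_not_dvd_forall_dvd_mul
    (hC : Function.Bijective (algebraMap R (Module.End R C))) {x : R} (hx : x ≠ 0)
    (hlift : ∀ g : C →ₗ[R] C ⧸ LinearMap.range (LinearMap.lsmul R C x),
      ∃ G : C →ₗ[R] C, (LinearMap.range (LinearMap.lsmul R C x)).mkQ ∘ₗ G = g)
    {p : Ideal R} [p.IsPrime] {c₀ : C} (hc₀ : ∀ r : R, r ∈ p ↔ ∃ c : C, r • c₀ = x • c) :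
    ∃ r, ¬ x ∣ r ∧ ∀ y ∈ p, x ∣ r * y := by
  set X := LinearMap.range (LinearMap.lsmul R C x) with hX
  have hmem (c : C) : c ∈ X ↔ ∃ d, c = x • d := by simp [hX, eq_comm]
  obtain ⟨h, hh⟩ := Module.Finite.exists_linearMap_quotient_ne_zero
    (Module.annihilator_eq_bot_of_injective_algebraMap_end hC.1) p
  let k : R ⧸ p →ₗ[R] C ⧸ X := p.liftQ (LinearMap.toSpanSingleton R _ (X.mkQ c₀)) fun r hr => by
    rw [LinearMap.mem_ker, LinearMap.toSpanSingleton_apply, ← map_smul, Submodule.mkQ_apply,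
      Submodule.Quotient.mk_eq_zero, hmem]
    exact (hc₀ r).mp hr
  have hk : Function.Injective k := by
    rw [injective_iff_map_eq_zero]
    intro q hq
    obtain ⟨r, rfl⟩ := Submodule.Quotient.mk_surjective _ q
    refine (Submodule.Quotient.mk_eq_zero _).mpr ((hc₀ r).mpr ((hmem _).mp ?_))
    rw [← Submodule.Quotient.mk_eq_zero, Submodule.Quotient.mk_smul]
    exact (Submodule.liftQ_apply p _ r).symm.trans hq
  obtain ⟨G, hG⟩ := hlift (k ∘ₗ h)
  obtain ⟨r, hr⟩ := Module.exists_forall_apply_eq_smul hC.2 G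
  have hG' (c : C) : k (h c) = X.mkQ (r • c) := by
    rw [← hr]
    exact congr($hG.symm c)
  refine ⟨r, ?_, fun y hy => ?_⟩
  · rintro ⟨s, rfl⟩
    refine hh (LinearMap.ext fun c => hk ?_)
    rw [hG', LinearMap.zero_apply, map_zero, Submodule.mkQ_apply, Submodule.Quotient.mk_eq_zero,
      hmem]
    exact ⟨s • c, mul_smul _ _ _⟩
  · have hyq (q : R ⧸ p) : y • q = 0 := by
      obtain ⟨s, rfl⟩ := Submodule.Quotient.mk_surjective _ q
      rw [← Submodule.Quotient.mk_smul]
      exact (Submodule.Quotient.mk_eq_zero _).mpr (p.mul_mem_right _ hy)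
    obtain ⟨H, hH⟩ := LinearMap.exists_eq_smul
      (isSMulRegular_of_bijective_algebraMap_end hC hx) (algebraMap R (Module.End R C) (r * y))
      fun c => by
        rw [Module.algebraMap_end_apply, ← hmem, ← Submodule.Quotient.mk_eq_zero,
          ← Submodule.mkQ_apply, mul_smul, ← hG', map_smul, hyq, map_zero]
    obtain ⟨s, rfl⟩ := hC.2 H
    refine ⟨s, hC.1 ?_⟩
    rw [hH, Algebra.smul_def, map_mul]

/-- Over an integrally closed Noetherian domain, a finite module `C` with `R ≃ End C` for which
maps `C → C / x C` lift to endomorphisms of `C` is reflexive. -/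
theorem Module.isReflexive_of_bijective_algebraMap_end [IsIntegrallyClosed R]
    (hC : Function.Bijective (algebraMap R (Module.End R C)))
    (hlift : ∀ x : R, x ≠ 0 → ∀ g : C →ₗ[R] C ⧸ LinearMap.range (LinearMap.lsmul R C x),
      ∃ G : C →ₗ[R] C, (LinearMap.range (LinearMap.lsmul R C x)).mkQ ∘ₗ G = g) :
    Module.IsReflexive R C := by
  have hinj := Module.injective_dual_eval_of_bijective_algebraMap_end hC
  refine ⟨hinj, ?_⟩
  by_contra hsurj
  set E := LinearMap.range (Module.Dual.eval R C) with hE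
  obtain ⟨ξ₀, hξ₀⟩ : ∃ ξ, ξ ∉ E := by simpa [Function.Surjective, hE] using hsurj
  obtain ⟨p, hp, -⟩ := exists_le_isAssociatedPrime_of_isNoetherianRing R (E.mkQ ξ₀)
    (by simpa using hξ₀)
  obtain ⟨hprime, q, hq⟩ := isAssociatedPrime_iff.mp hp
  obtain ⟨ξ, rfl⟩ := E.mkQ_surjective q
  have hξ (r : R) : r ∈ p ↔ ∃ c, Module.Dual.eval R C c = r • ξ := by
    rw [hq, Submodule.mem_colon_singleton, Submodule.mem_bot, ← map_smul, Submodule.mkQ_apply,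
      Submodule.Quotient.mk_eq_zero]
    exact LinearMap.mem_range
  have hmem (φ : C →ₗ[R] R) (a : C) : φ a ∈ p := by
    by_cases ha : φ a = 0
    · rw [ha]
      exact p.zero_mem
    · exact (hξ _).mpr ⟨_, (Module.smul_eq_dual_eval hC.2 φ a ha ξ).symm⟩
  obtain ⟨φ, a, hx⟩ := Module.exists_dual_apply_ne_zero_of_bijective_algebraMap_end hC
  obtain ⟨c₀, hc₀⟩ := (hξ (φ a)).mp (hmem φ a)
  generalize φ a = x at hx hc₀
  have hreg : IsSMulRegular (Module.Dual R (Module.Dual R C)) x := fun ζ η h =>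
    LinearMap.ext fun ψ => mul_left_cancel₀ hx congr($h ψ)
  obtain ⟨r, hr, hrp⟩ := exists_not_dvd_forall_dvd_mul hC hx (hlift x hx) (p := p) (c₀ := c₀)
    fun r => by
      rw [hξ]
      refine exists_congr fun c => ?_
      rw [← hinj.eq_iff, map_smul, map_smul, hc₀, smul_comm r x, eq_comm]
      exact hreg.eq_iff.symm
  obtain ⟨φ, hφ⟩ := Module.exists_dual_ne_zero_of_bijective_algebraMap_end hC
  obtain ⟨ψ, b, hb⟩ := exists_apply_notMem_of_dvd hx hr hrp hφ
  exact hb (hmem ψ b)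

end Semidualizing

theorem IsSemidualizing.isReflexive {R : Type} [CommRing R] [IsDomain R] [IsNoetherianRing R]
    [IsIntegrallyClosed R] {C : Type} [AddCommGroup C] [Module R C] (hC : IsSemidualizing R C) :
    Module.IsReflexive R C := by
  obtain ⟨hfin, hbij, hext⟩ := hC
  refine Module.isReflexive_of_bijective_algebraMap_end hbij fun x hx g => ?_
  exact LinearMap.exists_comp_eq_of_subsingleton_ext (f := LinearMap.lsmul R C x)
    (isSMulRegular_of_bijective_algebraMap_end hbij hx) (Submodule.mkQ_surjective _)
    (LinearMap.exact_map_mkQ_range _) (hext 1 one_pos) g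

/-- a normal domain with only finitely many isomorphism classes of rank-1
reflexive modules has only finitely many isomorphism classes of semidualizing modules. -/
theorem statement9
    (R : Type) [CommRing R] [IsDomain R] [IsNoetherianRing R] [IsIntegrallyClosed R]
    (hfin : ∃ (ι : Type) (_ : Finite ι) (F : ι → ModuleCat.{0} R),
      ∀ (M : Type) [AddCommGroup M] [Module R M], Module.Finite R M →
        Module.IsReflexive R M →
        Module.finrank (FractionRing R) (TensorProduct R (FractionRing R) M) = 1 →
        ∃ i, Nonempty (M ≃ₗ[R] ↥(F i))) :
    ∃ (ι : Type) (_ : Finite ι) (F : ι → ModuleCat.{0} R),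
      ∀ (M : Type) [AddCommGroup M] [Module R M], IsSemidualizing R M →
        ∃ i, Nonempty (M ≃ₗ[R] ↥(F i)) := by
  obtain ⟨ι, hι, F, hF⟩ := hfin
  refine ⟨ι, hι, F, fun M _ _ hM => ?_⟩
  have := hM.1
  exact hF M hM.1 hM.isReflexive (Module.finrank_eq_one_of_bijective_algebraMap_end hM.2.1)
end

section
/- Let φ: R → S be a flat ring homomorphism between normal domains, and let M be a reflexive R-module such that M ⊗_R Frac(R) is one-dimensional over Frac(R). Then M ⊗_R S is a reflexive S-module and (M ⊗_R S) ⊗_S Frac(S) is one-dimensional over Frac(S); that is, M ⊗_R S is a rank-1 reflexive S-module. -/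
open TensorProduct in
/-- For a flat base change, the dual of a finitely presented module commutes with base change. -/
noncomputable def Module.Dual.flatBaseChangeEquiv (R S M : Type*) [CommRing R] [CommRing S]
    [Algebra R S] [Module.Flat R S] [AddCommGroup M] [Module R M] [Module.FinitePresentation R M] :
    S ⊗[R] Module.Dual R M ≃ₗ[S] Module.Dual S (S ⊗[R] M) :=
  (Module.FinitePresentation.isBaseChange_map R M R S).equiv ≪≫ₗ
    LinearEquiv.congrRight (AlgebraTensorModule.rid R S S)

open TensorProduct in
theorem Module.Dual.flatBaseChangeEquiv_tmul_tmul (R S M : Type*) [CommRing R] [CommRing S]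
    [Algebra R S] [Module.Flat R S] [AddCommGroup M] [Module R M] [Module.FinitePresentation R M]
    (s t : S) (f : Module.Dual R M) (m : M) :
    Module.Dual.flatBaseChangeEquiv R S M (s ⊗ₜ f) (t ⊗ₜ m) = s * (f m • t) := by
  simp only [Module.Dual.flatBaseChangeEquiv, LinearEquiv.trans_apply, IsBaseChange.equiv_tmul,
    map_smul, LinearMap.smul_apply, smul_eq_mul]
  rfl

open TensorProduct in
/-- Flat base change preserves reflexivity of finite modules over a Noetherian ring. -/
theorem Module.IsReflexive.tensorProduct_of_flat (R S M : Type*) [CommRing R] [CommRing S]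
    [IsNoetherianRing R] [Algebra R S] [Module.Flat R S] [AddCommGroup M] [Module R M]
    [Module.Finite R M] [Module.IsReflexive R M] : Module.IsReflexive S (S ⊗[R] M) where
  bijective_dual_eval' := by
    have : Module.FinitePresentation R M := Module.finitePresentation_of_finite R M
    have : Module.FinitePresentation R (Module.Dual R M) :=
      Module.finitePresentation_of_finite R _
    let e : S ⊗[R] M ≃ₗ[S] Module.Dual S (Module.Dual S (S ⊗[R] M)) :=
      (Module.evalEquiv R M).baseChange R S ≪≫ₗ
        Module.Dual.flatBaseChangeEquiv R S (Module.Dual R M) ≪≫ₗ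
        (Module.Dual.flatBaseChangeEquiv R S M).symm.dualMap
    have he : Module.Dual.eval S (S ⊗[R] M) = e.toLinearMap := by
      refine LinearMap.ext fun x ↦ LinearMap.ext fun φ ↦ ?_
      obtain ⟨y, rfl⟩ := (Module.Dual.flatBaseChangeEquiv R S M).surjective φ
      induction x with
      | zero => simp
      | add x₁ x₂ h₁ h₂ => simp only [map_add, LinearMap.add_apply, h₁, h₂]
      | tmul s m =>
        induction y with
        | zero => simp
        | add y₁ y₂ h₁ h₂ => simp only [map_add, h₁, h₂]
        | tmul t f =>
          simp [e, Module.Dual.flatBaseChangeEquiv_tmul_tmul, mul_comm]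
    rw [he]
    exact e.bijective

open TensorProduct in
/-- The generic rank of a module is preserved by injective base change of domains. -/
theorem finrank_fractionRing_tensorProduct_tensorProduct (R S M : Type*) [CommRing R] [CommRing S]
    [IsDomain R] [IsDomain S] [Algebra R S] [FaithfulSMul R S] [AddCommGroup M] [Module R M] :
    Module.finrank (FractionRing S) (FractionRing S ⊗[S] (S ⊗[R] M)) =
      Module.finrank (FractionRing R) (FractionRing R ⊗[R] M) := by
  let := FractionRing.liftAlgebra R (FractionRing S)
  rw [(AlgebraTensorModule.cancelBaseChange R S (FractionRing S) (FractionRing S) M).finrank_eq,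
    ← (AlgebraTensorModule.cancelBaseChange R (FractionRing R) (FractionRing S)
      (FractionRing S) M).finrank_eq, Module.finrank_baseChange]


open CategoryTheory

/-- base change of a rank-1 reflexive module along a flat map of normal
domains is again rank-1 reflexive. -/
theorem statement12
    (R S : Type) [CommRing R] [CommRing S]
    [IsDomain R] [IsNoetherianRing R] [IsIntegrallyClosed R]
    [IsDomain S] [IsNoetherianRing S] [IsIntegrallyClosed S]
    [Algebra R S] [Module.Flat R S]
    (M : Type) [AddCommGroup M] [Module R M] [Module.Finite R M]
    (hrefl : Module.IsReflexive R M)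
    (hrank : Module.finrank (FractionRing R) (TensorProduct R (FractionRing R) M) = 1) :
    Module.IsReflexive S (TensorProduct R S M) ∧
    Module.finrank (FractionRing S)
      (TensorProduct S (FractionRing S) (TensorProduct R S M)) = 1 := by
  exact ⟨Module.IsReflexive.tensorProduct_of_flat R S M,
    (finrank_fractionRing_tensorProduct_tensorProduct R S M).trans hrank⟩
end
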